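/- arXiv:math/0703371 — 8 statements merged into one kernel-verified Lean document; each statement's English description precedes it below -/
import Mathlib

section
/- Let n ≥ 1 and let u be an n×n complex matrix that is strictly upper triangular (u_{i,j} = 0 whenever i ≥ j) and satisfies u² = 0. Then there exists a unique involution σ ∈ S_n² such that u = g · N_σ · g⁻¹ for some invertible upper-triangular complex n×n matrix g. -/
namespace LinkPat

variable {n : ℕ}

/-- `σ` is an involution (σ² = id). -/
def IsInvol (σ : Equiv.Perm (Fin n)) : Prop := ∀ p, σ (σ p) = p

/-- `(i,j)` is an arc of `σ`: `i < j` and `σ i = j`. -/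
def IsArc (σ : Equiv.Perm (Fin n)) (i j : Fin n) : Prop := i < j ∧ σ i = j

/-- The finite set of arcs of `σ`. -/
def arcs (σ : Equiv.Perm (Fin n)) : Finset (Fin n × Fin n) :=
  Finset.univ.filter fun a => a.1 < a.2 ∧ σ a.1 = a.2

/-- The number of arcs of `σ`. -/
def numArcs (σ : Equiv.Perm (Fin n)) : ℕ := (arcs σ).card

/-- `c(σ)`: the number of crossings, i.e. pairs of arcs `(i,j)`, `(i',j')` with
`i < i' < j < j'`. -/
def crossNum (σ : Equiv.Perm (Fin n)) : ℕ :=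
  ((arcs σ ×ˢ arcs σ).filter fun x => x.1.1 < x.2.1 ∧ x.2.1 < x.1.2 ∧ x.1.2 < x.2.2).card

/-- `f(σ)`: the sum over fixed points `p` of the number of arcs over `p`. -/
def fixNum (σ : Equiv.Perm (Fin n)) : ℕ :=
  (((Finset.univ.filter fun p => σ p = p) ×ˢ arcs σ).filter
    fun x => x.2.1 < x.1 ∧ x.1 < x.2.2).card

/-- The rank matrix `R_σ`: entry `(i,j)` is the number of arcs inside `[i,j]`. -/
def Rmat (σ : Equiv.Perm (Fin n)) (i j : Fin n) : ℕ :=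
  ((arcs σ).filter fun a => i ≤ a.1 ∧ a.2 ≤ j).card

/-- The partial order `σ' ⪯ σ` given by pointwise comparison of rank matrices. -/
def rle (σ' σ : Equiv.Perm (Fin n)) : Prop := ∀ i j, Rmat σ' i j ≤ Rmat σ i j

/-- The strict order `σ' ≺ σ`. -/
def rlt (σ' σ : Equiv.Perm (Fin n)) : Prop := rle σ' σ ∧ σ' ≠ σ

end LinkPat

/-- `N_σ`: the strictly upper-triangular 0–1 matrix of the involution `σ`. -/
def Nmat {n : ℕ} (σ : Equiv.Perm (Fin n)) : Matrix (Fin n) (Fin n) ℂ :=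
  fun i j => if i < j ∧ σ i = j then 1 else 0

open scoped Matrix

/-- An invertible upper-triangular matrix has nonzero diagonal entries. -/
theorem diag_ne_zero_of_isUnit_of_upperTriangular {n : ℕ} {A : Matrix (Fin n) (Fin n) ℂ}
    (hA : IsUnit A) (htri : A.BlockTriangular id) (i : Fin n) : A i i ≠ 0 := by
  have hdet := (Matrix.isUnit_iff_isUnit_det A).1 hA
  rw [Matrix.det_of_isUpperTriangular htri] at hdet
  exact Finset.prod_ne_zero_iff.1 hdet.ne_zero i (Finset.mem_univ i)

/-- An upper-triangular matrix with nonzero diagonal entries is invertible. -/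
theorem isUnit_of_upperTriangular {n : ℕ} {A : Matrix (Fin n) (Fin n) ℂ}
    (htri : A.BlockTriangular id) (hdiag : ∀ i, A i i ≠ 0) : IsUnit A := by
  rw [Matrix.isUnit_iff_isUnit_det, Matrix.det_of_isUpperTriangular htri]
  exact (Finset.prod_ne_zero_iff.2 fun i _ => hdiag i).isUnit

theorem units_inv_upperTriangular {n : ℕ} (g : (Matrix (Fin n) (Fin n) ℂ)ˣ)
    (hg : (g : Matrix (Fin n) (Fin n) ℂ).BlockTriangular id) :
    ((g⁻¹ : (Matrix (Fin n) (Fin n) ℂ)ˣ) : Matrix (Fin n) (Fin n) ℂ).BlockTriangular id := by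
  rw [Matrix.coe_units_inv]
  have := g.invertible
  exact Matrix.blockTriangular_inv_of_blockTriangular hg

/-- An upper-triangular intertwiner with nonzero diagonal can only move arcs inwards. -/
theorem le_of_Nmat_mul_eq_mul_Nmat {n : ℕ} {σ τ : Equiv.Perm (Fin n)}
    (hσ : LinkPat.IsInvol σ) (hτ : LinkPat.IsInvol τ) {A : Matrix (Fin n) (Fin n) ℂ}
    (htri : A.BlockTriangular id) (hdiag : ∀ i, A i i ≠ 0)
    (h : Nmat σ * A = A * Nmat τ) {j : Fin n} (hj : σ j < j) : τ j < j ∧ σ j ≤ τ j := by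
  have hentry := congrFun (congrFun h (σ j)) j
  have hl : (Nmat σ * A) (σ j) j = A j j := by
    rw [Matrix.mul_apply, Finset.sum_eq_single j]
    · simp [Nmat, hj, hσ j]
    · intro b _ hb
      simp [Nmat, hσ j, hb.symm]
    · simp
  rw [hl, Matrix.mul_apply] at hentry
  obtain ⟨k, -, hk⟩ := Finset.exists_ne_zero_of_sum_ne_zero (hentry ▸ hdiag j)
  have hN : k < j ∧ τ k = j := by
    by_contra hcon
    exact hk (by simp [Nmat, hcon])
  have hτj : τ j = k := by rw [← hN.2, hτ]
  rw [hτj]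
  refine ⟨hN.1, le_of_not_gt fun hlt => hk ?_⟩
  rw [htri hlt, zero_mul]

theorem involution_eq_of_arcs_eq {n : ℕ} {σ τ : Equiv.Perm (Fin n)}
    (hσ : LinkPat.IsInvol σ) (hτ : LinkPat.IsInvol τ)
    (h₁ : ∀ j, σ j < j → τ j = σ j) (h₂ : ∀ j, τ j < j → τ j = σ j) : τ = σ := by
  ext1 j
  rcases lt_trichotomy (σ j) j with h | h | h
  · exact h₁ j h
  · rcases lt_trichotomy (τ j) j with h' | h' | h'
    · exact h₂ j h'
    · rw [h, h']
    · have := h₂ (τ j) (by rwa [hτ])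
      rw [hτ] at this
      rw [← hσ (τ j), ← this]
  · have := h₁ (σ j) (by rwa [hσ])
    rw [hσ] at this
    rw [← hτ (σ j), this]

/-- A family of vectors adapted to the standard flag spans each step of the flag. -/
theorem exists_sum_smul_eq_of_flag {n : ℕ} {g : Fin n → Fin n → ℂ}
    (htri : ∀ j i, j < i → g j i = 0) (hdiag : ∀ j, g j j ≠ 0)
    {w : Fin n → ℂ} {k : Fin n} (hw : ∀ i, k ≤ i → w i = 0) :
    ∃ c : Fin n → ℂ, (∀ i, k ≤ i → c i = 0) ∧ ∑ i, c i • g i = w := by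
  set M : Matrix (Fin n) (Fin n) ℂ := (Matrix.of g)ᵀ with hM
  have hMtri : M.BlockTriangular id := fun i j hij => htri j i hij
  obtain ⟨G, hG⟩ := isUnit_of_upperTriangular hMtri hdiag
  have hinv := units_inv_upperTriangular G (hG ▸ hMtri)
  refine ⟨(↑G⁻¹ : Matrix (Fin n) (Fin n) ℂ) *ᵥ w, fun i hi => ?_, ?_⟩
  · rw [Matrix.mulVec, dotProduct]
    refine Finset.sum_eq_zero fun j _ => ?_
    rcases lt_or_ge j i with hij | hij
    · rw [hinv hij, zero_mul]
    · rw [hw j (hi.trans hij), mul_zero]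
  · have : M *ᵥ ((↑G⁻¹ : Matrix (Fin n) (Fin n) ℂ) *ᵥ w) = w := by
      rw [← hG, Matrix.mulVec_mulVec, Units.mul_inv, Matrix.one_mulVec]
    rw [Matrix.mulVec_eq_sum] at this
    simp only [hM, Matrix.transpose_transpose, op_smul_eq_smul] at this
    exact this

theorem linearIndependent_of_flag {n : ℕ} {g : Fin n → Fin n → ℂ}
    (htri : ∀ j i, j < i → g j i = 0) (hdiag : ∀ j, g j j ≠ 0) :
    LinearIndependent ℂ g := by
  have hMtri : (Matrix.of g)ᵀ.BlockTriangular id := fun i j hij => htri j i hij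
  have := Matrix.linearIndependent_cols_of_isUnit (isUnit_of_upperTriangular hMtri hdiag)
  exact this

/-- The family `g` is adapted to the standard flag, and `u` acts on its first `k` vectors as
`N_σ` acts on the standard basis. -/
structure IsPartialNormalForm {n : ℕ} (u : Matrix (Fin n) (Fin n) ℂ) (k : ℕ)
    (σ : Equiv.Perm (Fin n)) (g : Fin n → Fin n → ℂ) : Prop where
  invol : LinkPat.IsInvol σ
  fixed : ∀ j : Fin n, k ≤ j → σ j = j
  tri : ∀ j i, j < i → g j i = 0
  diag : ∀ j, g j j ≠ 0
  act : ∀ j : Fin n, (j : ℕ) < k → u *ᵥ g j = if σ j < j then g (σ j) else 0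

/-- The vector `u g_k` can be made a combination of vectors `g_i` with `i < k` fixed by `σ`. -/
theorem IsPartialNormalForm.exists_reduced {n : ℕ} {u : Matrix (Fin n) (Fin n) ℂ}
    (hupper : ∀ i j : Fin n, j ≤ i → u i j = 0) (hsq : u * u = 0) {k : Fin n}
    {σ : Equiv.Perm (Fin n)} {g : Fin n → Fin n → ℂ} (h : IsPartialNormalForm u k σ g) :
    ∃ (v : Fin n → ℂ) (c : Fin n → ℂ), (∀ i, k < i → v i = 0) ∧ v k ≠ 0 ∧
      (∀ i, c i ≠ 0 → i < k ∧ σ i = i) ∧ u *ᵥ v = ∑ i, c i • g i := by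
  have hσlt : ∀ i, i < σ i → σ i < k := fun i hi => by
    by_contra hcon
    have := h.fixed (σ i) (by simpa using hcon)
    rw [h.invol] at this
    exact hi.ne this
  have hw : ∀ i, k ≤ i → (u *ᵥ g k) i = 0 := fun i hi => by
    rw [Matrix.mulVec, dotProduct]
    refine Finset.sum_eq_zero fun j _ => ?_
    rcases le_or_gt j i with hji | hji
    · rw [hupper i j hji, zero_mul]
    · rw [h.tri k j (hi.trans_lt hji), mul_zero]
  obtain ⟨c, hc, hsum⟩ := exists_sum_smul_eq_of_flag h.tri h.diag hw
  have hzero : ∑ i, (if i < σ i then c (σ i) else 0) • g i = 0 := by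
    have huu : u *ᵥ (u *ᵥ g k) = 0 := by rw [Matrix.mulVec_mulVec, hsq, Matrix.zero_mulVec]
    rw [← hsum, Matrix.mulVec_sum] at huu
    rw [← huu, ← Equiv.sum_comp σ]
    refine Finset.sum_congr rfl fun i _ => ?_
    rw [Matrix.mulVec_smul, h.invol]
    rcases lt_or_ge i k with hik | hik
    · rw [h.act i hik]
      split_ifs <;> simp
    · simp [hc i hik]
  have hclosed : ∀ i, σ i < i → c i = 0 := fun i hi => by
    have := Fintype.linearIndependent_iff.1 (linearIndependent_of_flag h.tri h.diag) _ hzero (σ i)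
    simpa [h.invol i, hi] using this
  refine ⟨g k - ∑ i, (if i < σ i then c i else 0) • g (σ i),
    fun i => if σ i = i then c i else 0, fun i hi => ?_, ?_, fun i hi => ?_, ?_⟩
  · rw [Pi.sub_apply, h.tri k i hi, Finset.sum_apply, Finset.sum_eq_zero, sub_zero]
    intro j _
    split_ifs with hj
    · simp [h.tri (σ j) i ((hσlt j hj).trans hi)]
    · simp
  · rw [Pi.sub_apply, Finset.sum_apply, Finset.sum_eq_zero, sub_zero]
    · exact h.diag k
    · intro j _
      split_ifs with hj
      · simp [h.tri (σ j) k (hσlt j hj)]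
      · simp
  · have hi' : σ i = i ∧ c i ≠ 0 := by simpa using hi
    exact ⟨lt_of_not_ge fun hik => hi'.2 (hc i hik), hi'.1⟩
  · rw [Matrix.mulVec_sub, ← hsum, Matrix.mulVec_sum, ← Finset.sum_sub_distrib]
    refine Finset.sum_congr rfl fun i _ => ?_
    rw [Matrix.mulVec_smul]
    rcases lt_trichotomy (σ i) i with hi | hi | hi
    · simp [hclosed i hi]
    · simp [hi]
    · rw [h.act (σ i) (hσlt i hi), h.invol]
      simp [hi, hi.ne']

theorem IsPartialNormalForm.exists_succ {n : ℕ} {u : Matrix (Fin n) (Fin n) ℂ}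
    (hupper : ∀ i j : Fin n, j ≤ i → u i j = 0) (hsq : u * u = 0) {k : Fin n}
    {σ : Equiv.Perm (Fin n)} {g : Fin n → Fin n → ℂ} (h : IsPartialNormalForm u k σ g) :
    ∃ σ' g', IsPartialNormalForm u (k + 1) σ' g' := by
  obtain ⟨v, c, hvtri, hvdiag, hc, huv⟩ := h.exists_reduced hupper hsq
  have hσk : σ k = k := h.fixed k le_rfl
  by_cases hzero : ∀ i, c i = 0
  · refine ⟨σ, Function.update g k v, h.invol, fun j hj => h.fixed j (by omega), ?_, ?_, ?_⟩
    · intro j i hij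
      rcases eq_or_ne j k with rfl | hjk
      · simpa using hvtri i hij
      · simpa [hjk] using h.tri j i hij
    · intro j
      rcases eq_or_ne j k with rfl | hjk
      · simpa using hvdiag
      · simpa [hjk] using h.diag j
    · intro j hj
      rcases eq_or_ne j k with rfl | hjk
      · simp [huv, hzero, hσk]
      · have hσj : σ j ≠ k := fun hcon => hjk (σ.injective (hcon.trans hσk.symm))
        simpa [hjk, hσj] using h.act j (by have := Fin.val_ne_of_ne hjk; omega)
  · obtain ⟨m, hm, hmax⟩ : ∃ m, c m ≠ 0 ∧ ∀ i, m < i → c i = 0 := by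
      push Not at hzero
      have hne : (Finset.univ.filter fun i => c i ≠ 0).Nonempty := by
        obtain ⟨i, hi⟩ := hzero
        exact ⟨i, by simp [hi]⟩
      refine ⟨_, (Finset.mem_filter.1 (Finset.max'_mem _ hne)).2, fun i hi => ?_⟩
      by_contra hcon
      exact (Finset.le_max' _ i (by simp [hcon])).not_gt hi
    obtain ⟨hmk, hσm⟩ := hc m hm
    set w := ∑ i, c i • g i with hw
    have hwtri : ∀ i, m < i → w i = 0 := fun i hi => by
      rw [hw, Finset.sum_apply]
      refine Finset.sum_eq_zero fun j _ => ?_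
      rcases lt_or_ge m j with hj | hj
      · simp [hmax j hj]
      · simp [h.tri j i (hj.trans_lt hi)]
    have hwdiag : w m ≠ 0 := by
      rw [hw, Finset.sum_apply, Finset.sum_eq_single m]
      · simpa using ⟨hm, h.diag m⟩
      · intro j _ hj
        rcases lt_or_gt_of_ne hj with hj | hj
        · simp [h.tri j m hj]
        · simp [hmax j hj]
      · simp
    have huw : u *ᵥ w = 0 := by
      rw [hw, Matrix.mulVec_sum]
      refine Finset.sum_eq_zero fun i _ => ?_
      rw [Matrix.mulVec_smul]
      by_cases hi : c i = 0
      · simp [hi]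
      · rw [h.act i (hc i hi).1]
        simp [(hc i hi).2]
    have hσ' : ∀ j, j ≠ k → j ≠ m → (σ * Equiv.swap m k) j = σ j := fun j hjk hjm => by
      simp [Equiv.swap_apply_of_ne_of_ne hjm hjk]
    have hσ'k : (σ * Equiv.swap m k) k = m := by simp [hσm]
    have hσ'm : (σ * Equiv.swap m k) m = k := by simp [hσk]
    have hne : ∀ j, j ≠ k → j ≠ m → σ j ≠ k ∧ σ j ≠ m := fun j hjk hjm =>
      ⟨fun hcon => hjk (σ.injective (hcon.trans hσk.symm)),
        fun hcon => hjm (σ.injective (hcon.trans hσm.symm))⟩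
    generalize σ * Equiv.swap m k = τ at hσ' hσ'k hσ'm
    refine ⟨τ, Function.update (Function.update g m w) k v, ?_, ?_, ?_, ?_, ?_⟩
    · intro j
      rcases eq_or_ne j k with rfl | hjk
      · rw [hσ'k, hσ'm]
      rcases eq_or_ne j m with rfl | hjm
      · rw [hσ'm, hσ'k]
      rw [hσ' j hjk hjm, hσ' _ (hne j hjk hjm).1 (hne j hjk hjm).2, h.invol]
    · intro j hj
      have hkj : k < j := Fin.lt_def.2 (by omega)
      rw [hσ' j hkj.ne' (hmk.trans hkj).ne', h.fixed j (by omega)]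
    · intro j i hij
      rcases eq_or_ne j k with rfl | hjk
      · simpa using hvtri i hij
      rcases eq_or_ne j m with rfl | hjm
      · simpa [hjk] using hwtri i hij
      simpa [hjk, hjm] using h.tri j i hij
    · intro j
      rcases eq_or_ne j k with rfl | hjk
      · simpa using hvdiag
      rcases eq_or_ne j m with rfl | hjm
      · simpa [hjk] using hwdiag
      simpa [hjk, hjm] using h.diag j
    · intro j hj
      rcases eq_or_ne j k with rfl | hjk
      · simp [hσ'k, hmk, hmk.ne, huv]
      rcases eq_or_ne j m with rfl | hjm
      · simp [hσ'm, hmk.not_gt, hjk, huw]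
      · rw [hσ' j hjk hjm]
        simpa [hjk, hjm, hne j hjk hjm] using
          h.act j (by have := Fin.val_ne_of_ne hjk; omega)

theorem exists_isPartialNormalForm {n : ℕ} {u : Matrix (Fin n) (Fin n) ℂ}
    (hupper : ∀ i j : Fin n, j ≤ i → u i j = 0) (hsq : u * u = 0) (k : ℕ) (hk : k ≤ n) :
    ∃ σ g, IsPartialNormalForm u k σ g := by
  induction k with
  | zero =>
    exact ⟨1, fun j => Pi.single j 1, fun _ => rfl, fun _ _ => rfl,
      fun j i hij => by simp [hij.ne'], fun j => by simp, fun j hj => by omega⟩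
  | succ k ih =>
    obtain ⟨σ, g, h⟩ := ih (by omega)
    exact IsPartialNormalForm.exists_succ hupper hsq (k := ⟨k, by omega⟩) h

theorem exists_involution_conj {n : ℕ} {u : Matrix (Fin n) (Fin n) ℂ}
    (hupper : ∀ i j : Fin n, j ≤ i → u i j = 0) (hsq : u * u = 0) :
    ∃ σ : Equiv.Perm (Fin n), LinkPat.IsInvol σ ∧
      ∃ g : (Matrix (Fin n) (Fin n) ℂ)ˣ,
        (g : Matrix (Fin n) (Fin n) ℂ).BlockTriangular id ∧
        u = (g : Matrix (Fin n) (Fin n) ℂ) * Nmat σ *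
              ((g⁻¹ : (Matrix (Fin n) (Fin n) ℂ)ˣ) : Matrix (Fin n) (Fin n) ℂ) := by
  obtain ⟨σ, g, h⟩ := exists_isPartialNormalForm hupper hsq n le_rfl
  have hMtri : (Matrix.of g)ᵀ.BlockTriangular id := fun i j hij => h.tri j i hij
  obtain ⟨G, hG⟩ := isUnit_of_upperTriangular hMtri h.diag
  refine ⟨σ, h.invol, G, hG ▸ hMtri, ?_⟩
  rw [Units.eq_mul_inv_iff_mul_eq, hG]
  ext i j
  have hl : (u * (Matrix.of g)ᵀ) i j = (u *ᵥ g j) i := rfl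
  rw [hl, h.act j j.2, Matrix.mul_apply, Finset.sum_eq_single (σ j)]
  · by_cases hj : σ j < j <;> simp [Nmat, hj, h.invol j]
  · intro b _ hb
    have : σ b ≠ j := fun hcon => hb (by rw [← hcon, h.invol])
    simp [Nmat, this]
  · simp

/-- every strictly upper-triangular square-zero complex matrix is
conjugate, by an invertible upper-triangular matrix, to `N_σ` for a unique
involution `σ`. -/
theorem exists_unique_involution_conj (n : ℕ) (hn : 1 ≤ n)
    (u : Matrix (Fin n) (Fin n) ℂ)
    (hupper : ∀ i j : Fin n, j ≤ i → u i j = 0)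
    (hsq : u * u = 0) :
    ∃! σ : Equiv.Perm (Fin n), LinkPat.IsInvol σ ∧
      ∃ g : (Matrix (Fin n) (Fin n) ℂ)ˣ,
        (∀ i j : Fin n, j < i → (g : Matrix (Fin n) (Fin n) ℂ) i j = 0) ∧
        u = (g : Matrix (Fin n) (Fin n) ℂ) * Nmat σ *
              ((g⁻¹ : (Matrix (Fin n) (Fin n) ℂ)ˣ) : Matrix (Fin n) (Fin n) ℂ) := by
  obtain ⟨σ, hσ, g, hg, hu⟩ := exists_involution_conj hupper hsq
  refine ⟨σ, ⟨hσ, g, fun i j hij => hg hij, hu⟩, ?_⟩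
  rintro τ ⟨hτ, h, hh, hu'⟩
  have hh' : (h : Matrix (Fin n) (Fin n) ℂ).BlockTriangular id := fun i j hij => hh i j hij
  have key : ∀ {ρ π : Equiv.Perm (Fin n)} (a b : (Matrix (Fin n) (Fin n) ℂ)ˣ),
      LinkPat.IsInvol ρ → LinkPat.IsInvol π →
      (a : Matrix (Fin n) (Fin n) ℂ).BlockTriangular id →
      (b : Matrix (Fin n) (Fin n) ℂ).BlockTriangular id →
      u = a.1 * Nmat ρ * (a⁻¹).1 → u = b.1 * Nmat π * (b⁻¹).1 →
      ∀ j, ρ j < j → π j < j ∧ ρ j ≤ π j := by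
    intro ρ π a b hρ hπ ha hb hua hub j hj
    have htri : (a⁻¹ * b).1.BlockTriangular id := (units_inv_upperTriangular a ha).mul hb
    refine le_of_Nmat_mul_eq_mul_Nmat hρ hπ htri
      (diag_ne_zero_of_isUnit_of_upperTriangular (a⁻¹ * b).isUnit htri) ?_ hj
    have hua' : (a⁻¹).1 * u = Nmat ρ * (a⁻¹).1 := by
      rw [hua, mul_assoc, Units.inv_mul_cancel_left]
    have hub' : u * b.1 = b.1 * Nmat π := by
      rw [hub, Units.inv_mul_cancel_right]
    rw [Units.val_mul, ← mul_assoc, ← hua', mul_assoc, hub', mul_assoc]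
  have hστ := key g h hσ hτ hg hh' hu hu'
  have hτσ := key h g hτ hσ hh' hg hu' hu
  exact involution_eq_of_arcs_eq hσ hτ
    (fun j hj => le_antisymm (hτσ j (hστ j hj).1).2 (hστ j hj).2)
    (fun j hj => le_antisymm (hτσ j hj).2 (hστ j (hτσ j hj).1).2)
end

section
/- Let σ ∈ S_n² have exactly k arcs (i_1,j_1), ..., (i_k,j_k). Then k·n − Σ_{s=1}^k (j_s − i_s) − Σ_{s=1}^k q_{(i_s,j_s)}(σ) = k(n−k) − c(σ) − f(σ). (This identity shows that the two formulas for the dimension of the B-orbit of N_σ agree.) -/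
/-- `q_{(i,j)}(σ)` for an arc `a = (i,j)` of `σ`. -/
def qstat {n : ℕ} (σ : Equiv.Perm (Fin n)) (a : Fin n × Fin n) : ℕ :=
  ((LinkPat.arcs σ).filter fun b => b.1 < a.1 ∧ b.2 < a.2).card +
  ((LinkPat.arcs σ).filter fun b => b.2 < a.1).card

namespace LinkPat

/-- The points of an involution split into fixed points, left ends and right ends of arcs. -/
theorem sum_eq_sum_fixed_add_sum_arcs {n : ℕ} {M : Type*} [AddCommMonoid M]
    {σ : Equiv.Perm (Fin n)} (hσ : IsInvol σ) (g : Fin n → M) :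
    ∑ p, g p = ∑ p with σ p = p, g p + ∑ a ∈ arcs σ, (g a.1 + g a.2) := by
  have left : ∑ a ∈ arcs σ, g a.1 = ∑ p with p < σ p, g p := by
    refine Finset.sum_nbij' (fun a => a.1) (fun p => (p, σ p)) ?_ ?_ ?_ ?_ ?_ <;>
      simp +contextual [arcs]
  have right : ∑ a ∈ arcs σ, g a.2 = ∑ p with σ p < p, g p := by
    refine Finset.sum_nbij' (fun a => a.2) (fun p => (σ p, p)) ?_ ?_ ?_ ?_ ?_
    · rintro ⟨i, j⟩ h
      simp only [arcs, Finset.mem_filter, Finset.mem_univ, true_and] at h ⊢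
      obtain ⟨h, rfl⟩ := h
      rwa [hσ]
    · intro p hp
      simpa [arcs, hσ p] using hp
    · rintro ⟨i, j⟩ h
      simp only [arcs, Finset.mem_filter, Finset.mem_univ, true_and] at h
      rw [← h.2, hσ]
    · simp
    · simp
  rw [Finset.sum_add_distrib, left, right, Finset.sum_filter, Finset.sum_filter,
    Finset.sum_filter, ← Finset.sum_add_distrib, ← Finset.sum_add_distrib]
  refine Finset.sum_congr rfl fun p _ => ?_
  rcases lt_trichotomy (σ p) p with h | h | h
  · simp [h, h.ne, h.not_gt]
  · simp [h]
  · simp [h, h.ne', h.not_gt]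

/-- Two arcs of an involution are equal or have disjoint sets of end points. -/
theorem eq_or_ne_of_mem_arcs {n : ℕ} {σ : Equiv.Perm (Fin n)} (hσ : IsInvol σ)
    {a b : Fin n × Fin n} (ha : a ∈ arcs σ) (hb : b ∈ arcs σ) :
    a = b ∨ a.1 ≠ b.1 ∧ a.1 ≠ b.2 ∧ a.2 ≠ b.1 ∧ a.2 ≠ b.2 := by
  obtain ⟨i, j⟩ := a
  obtain ⟨i', j'⟩ := b
  simp only [arcs, Finset.mem_filter, Finset.mem_univ, true_and] at ha hb
  have hi := hσ i
  have hi' := hσ i'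
  grind

/-- The length of an arc counts the points it covers, its right end included. -/
theorem arc_length_eq {n : ℕ} {σ : Equiv.Perm (Fin n)} (hσ : IsInvol σ)
    {a : Fin n × Fin n} (ha : a ∈ arcs σ) :
    ((a.2 : ℕ) : ℤ) - ((a.1 : ℕ) : ℤ) =
      (∑ p with σ p = p, if a.1 < p ∧ p < a.2 then (1 : ℤ) else 0) +
      ∑ b ∈ arcs σ, ((if a.1 < b.1 ∧ b.1 ≤ a.2 then 1 else 0) +
        if a.1 < b.2 ∧ b.2 ≤ a.2 then 1 else 0) := by
  have hlt : a.1 < a.2 ∧ σ a.1 = a.2 := by simpa [arcs] using ha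
  have hcard : ((a.2 : ℕ) : ℤ) - ((a.1 : ℕ) : ℤ) =
      ∑ p, if a.1 < p ∧ p ≤ a.2 then (1 : ℤ) else 0 := by
    have h : (Finset.univ.filter fun p => a.1 < p ∧ p ≤ a.2) = Finset.Ioc a.1 a.2 := by
      ext; simp
    rw [Finset.sum_boole, h, Fin.card_Ioc, Nat.cast_sub (Fin.le_def.1 hlt.1.le)]
  rw [hcard, sum_eq_sum_fixed_add_sum_arcs hσ]
  congr 1
  refine Finset.sum_congr rfl fun p hp => ?_
  have hp : σ p = p := by simpa using hp
  have hne : p ≠ a.2 := by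
    rintro rfl
    exact hlt.1.ne (σ.injective (hlt.2.trans hp.symm))
  simp only [lt_iff_le_and_ne (a := p), ne_eq, hne, not_false_eq_true, and_true]

/-- The points covered by arcs and the pairs counted by `qstat` number the pairs of arcs plus
the crossings. -/
theorem sum_covered_ends_add_qstat {n : ℕ} {σ : Equiv.Perm (Fin n)} (hσ : IsInvol σ) :
    (∑ a ∈ arcs σ, ∑ b ∈ arcs σ, ((if a.1 < b.1 ∧ b.1 ≤ a.2 then (1 : ℤ) else 0) +
        if a.1 < b.2 ∧ b.2 ≤ a.2 then 1 else 0)) + ∑ a ∈ arcs σ, (qstat σ a : ℤ) =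
      (numArcs σ : ℤ) * numArcs σ + crossNum σ := by
  have hq : ∀ a, (qstat σ a : ℤ) = ∑ b ∈ arcs σ,
      ((if b.1 < a.1 ∧ b.2 < a.2 then (1 : ℤ) else 0) + if b.2 < a.1 then 1 else 0) := by
    intro a
    rw [Finset.sum_add_distrib, Finset.sum_boole, Finset.sum_boole, qstat, Nat.cast_add]
  have hc : (numArcs σ : ℤ) * numArcs σ + crossNum σ = ∑ a ∈ arcs σ, ∑ b ∈ arcs σ,
      (1 + if a.1 < b.1 ∧ b.1 < a.2 ∧ a.2 < b.2 then (1 : ℤ) else 0) := by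
    rw [crossNum, ← Finset.sum_boole, Finset.sum_product]
    simp [Finset.sum_add_distrib, numArcs]
  simp only [hq]
  rw [hc, ← Finset.sum_add_distrib]
  simp only [← Finset.sum_add_distrib]
  refine mul_left_cancel₀ (two_ne_zero (α := ℤ)) ?_
  rw [two_mul, two_mul]
  nth_rw 2 [Finset.sum_comm]
  nth_rw 4 [Finset.sum_comm]
  simp only [← Finset.sum_add_distrib]
  refine Finset.sum_congr rfl fun a ha => Finset.sum_congr rfl fun b hb => ?_
  have h := eq_or_ne_of_mem_arcs hσ ha hb
  have ha : a.1 < a.2 := (Finset.mem_filter.1 ha).2.1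
  have hb : b.1 < b.2 := (Finset.mem_filter.1 hb).2.1
  rcases h with rfl | h
  · simp [ha, ha.not_gt]
  · obtain ⟨h₁, h₂, h₃, h₄⟩ := h
    rcases h₁.lt_or_gt with h₁ | h₁ <;> rcases h₂.lt_or_gt with h₂ | h₂ <;>
      rcases h₃.lt_or_gt with h₃ | h₃ <;> rcases h₄.lt_or_gt with h₄ | h₄ <;>
      simp only [h₁, h₂, h₃, h₄, h₂.le, h₃.le, h₄.le, h₁.not_gt, h₂.not_gt, h₃.not_gt,
        h₄.not_gt, h₂.not_ge, h₃.not_ge, h₄.not_ge, and_true, and_false, if_true,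
        if_false] <;>
      first | rfl | (exfalso; order)

theorem fixNum_eq_sum {n : ℕ} (σ : Equiv.Perm (Fin n)) :
    (fixNum σ : ℤ) =
      ∑ a ∈ arcs σ, ∑ p with σ p = p, if a.1 < p ∧ p < a.2 then (1 : ℤ) else 0 := by
  rw [fixNum, ← Finset.sum_boole, Finset.sum_product_right]

end LinkPat

/-- the two formulas for the dimension of the B-orbit agree:
`k·n − Σ (j_s − i_s) − Σ q_{(i_s,j_s)}(σ) = k(n−k) − c(σ) − f(σ)`. -/
theorem dim_formulas_agree (n k : ℕ) (σ : Equiv.Perm (Fin n))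
    (hσ : LinkPat.IsInvol σ) (hk : LinkPat.numArcs σ = k) :
    (k : ℤ) * (n : ℤ)
      - (∑ a ∈ LinkPat.arcs σ, (((a.2 : ℕ) : ℤ) - ((a.1 : ℕ) : ℤ)))
      - (∑ a ∈ LinkPat.arcs σ, (qstat σ a : ℤ))
    = (k : ℤ) * ((n : ℤ) - (k : ℤ))
      - (LinkPat.crossNum σ : ℤ) - (LinkPat.fixNum σ : ℤ) := by
  have hlen := Finset.sum_congr rfl fun a ha => LinkPat.arc_length_eq hσ (a := a) ha
  rw [Finset.sum_add_distrib, ← LinkPat.fixNum_eq_sum] at hlen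
  have hpairs := LinkPat.sum_covered_ends_add_qstat hσ
  rw [hk] at hpairs
  linear_combination -hlen - hpairs
end

section
/- Let R be an n×n matrix with nonnegative integer entries, with the convention that any entry R_{i,j} with an index outside {1,...,n} is taken to be 0. Then R = R_σ for some involution σ ∈ S_n² if and only if the following hold: (i) R_{i,j} = 0 whenever i ≥ j; (ii) for all i < j, R_{i+1,j} ≤ R_{i,j} ≤ R_{i+1,j} + 1 and R_{i,j−1} ≤ R_{i,j} ≤ R_{i,j−1} + 1; (iii) whenever R_{i,j} = R_{i+1,j} + 1 = R_{i,j−1} + 1 = R_{i+1,j−1} + 1, one has: (a) R_{i,m} = R_{i+1,m} for all m < j and R_{i,m} = R_{i+1,m} + 1 for all m ≥ j; (b) R_{m,j} = R_{m,j−1} for all m > i and R_{m,j} = R_{m,j−1} + 1 for all m ≤ i; (c) R_{j,m} = R_{j+1,m} and R_{m,i} = R_{m,i−1} for all 1 ≤ m ≤ n. -/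
namespace LinkPat

variable {n : ℕ}

/-- The number of pairs of `A` lying inside the interval `[i, j]`. -/
def rankCount (A : Finset (ℕ × ℕ)) (i j : ℕ) : ℕ :=
  (A.filter fun x => i ≤ x.1 ∧ x.2 ≤ j).card

/-- A set of pairs `(a, b)` with `1 ≤ a < b ≤ n`, no two of which share an endpoint. -/
structure IsArcSet (n : ℕ) (A : Finset (ℕ × ℕ)) : Prop where
  one_le : ∀ a b, (a, b) ∈ A → 1 ≤ a
  lt : ∀ a b, (a, b) ∈ A → a < b
  le : ∀ a b, (a, b) ∈ A → b ≤ n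
  right_unique : ∀ a b c, (a, b) ∈ A → (a, c) ∈ A → b = c
  left_unique : ∀ a b c, (a, c) ∈ A → (b, c) ∈ A → a = b
  not_chain : ∀ a b c, (a, b) ∈ A → (b, c) ∉ A

open Classical in
theorem IsArcSet.rankCount_row {A : Finset (ℕ × ℕ)} (hA : IsArcSet n A) (i j : ℕ) :
    rankCount A i j = rankCount A (i + 1) j + if ∃ k ≤ j, (i, k) ∈ A then 1 else 0 := by
  split_ifs with h
  · obtain ⟨k, hk, hik⟩ := h
    have : (A.filter fun x => i ≤ x.1 ∧ x.2 ≤ j) =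
        insert (i, k) (A.filter fun x => i + 1 ≤ x.1 ∧ x.2 ≤ j) := by
      ext ⟨a, b⟩
      have := hA.right_unique i b k
      simp only [Finset.mem_filter, Finset.mem_insert, Prod.mk.injEq]
      grind
    rw [rankCount, this, Finset.card_insert_of_notMem (by simp), rankCount]
  · rw [rankCount, rankCount, add_zero]
    congr 1
    ext ⟨a, b⟩
    simp only [Finset.mem_filter]
    grind

open Classical in
theorem IsArcSet.rankCount_col {A : Finset (ℕ × ℕ)} (hA : IsArcSet n A) (i j : ℕ)
    (hj : 1 ≤ j) :
    rankCount A i j = rankCount A i (j - 1) + if ∃ k ≥ i, (k, j) ∈ A then 1 else 0 := by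
  split_ifs with h
  · obtain ⟨k, hk, hkj⟩ := h
    have : (A.filter fun x => i ≤ x.1 ∧ x.2 ≤ j) =
        insert (k, j) (A.filter fun x => i ≤ x.1 ∧ x.2 ≤ j - 1) := by
      ext ⟨a, b⟩
      have := hA.left_unique a k j
      simp only [Finset.mem_filter, Finset.mem_insert, Prod.mk.injEq]
      grind
    rw [rankCount, this, Finset.card_insert_of_notMem (by simp; omega), rankCount]
  · rw [rankCount, rankCount, add_zero]
    congr 1
    ext ⟨a, b⟩
    simp only [Finset.mem_filter]
    grind

theorem IsArcSet.rankCount_eq_zero {A : Finset (ℕ × ℕ)} (hA : IsArcSet n A) {i j : ℕ}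
    (h : j ≤ i ∨ n ≤ i) : rankCount A i j = 0 := by
  rw [rankCount, Finset.card_eq_zero, Finset.filter_eq_empty_iff]
  rintro ⟨a, b⟩ hab
  have := hA.lt a b hab
  have := hA.le a b hab
  dsimp only
  omega

/-- The conditions satisfied by rank matrices of involutions, with 1-based indices. -/
def IsRankMatrix (n : ℕ) (R : ℕ → ℕ → ℕ) : Prop :=
    (∀ i j : ℕ, j ≤ i → R i j = 0) ∧
     (∀ i j : ℕ, 1 ≤ i → i < j → j ≤ n →
        R (i + 1) j ≤ R i j ∧ R i j ≤ R (i + 1) j + 1 ∧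
        R i (j - 1) ≤ R i j ∧ R i j ≤ R i (j - 1) + 1) ∧
     (∀ i j : ℕ, 1 ≤ i → i < j → j ≤ n →
        R i j = R (i + 1) j + 1 → R i j = R i (j - 1) + 1 →
        R i j = R (i + 1) (j - 1) + 1 →
        ((∀ m, m < j → R i m = R (i + 1) m) ∧
         (∀ m, j ≤ m → m ≤ n → R i m = R (i + 1) m + 1)) ∧
        ((∀ m, i < m → R m j = R m (j - 1)) ∧
         (∀ m, 1 ≤ m → m ≤ i → R m j = R m (j - 1) + 1)) ∧
        (∀ m, 1 ≤ m → m ≤ n → R j m = R (j + 1) m ∧ R m i = R m (i - 1)))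

theorem IsArcSet.isRankMatrix {A : Finset (ℕ × ℕ)} (hA : IsArcSet n A)
    {R : ℕ → ℕ → ℕ}
    (hbound : ∀ i j : ℕ, (i = 0 ∨ j = 0 ∨ n < i ∨ n < j) → R i j = 0)
    (hR : ∀ i j, 1 ≤ i → i ≤ n → 1 ≤ j → j ≤ n → R i j = rankCount A i j) :
    IsRankMatrix n R := by
  have hR' : ∀ i j, 1 ≤ i → j ≤ n → R i j = rankCount A i j := by
    intro i j hi hj
    by_cases h : i ≤ n ∧ 1 ≤ j
    · exact hR i j hi h.1 h.2 hj
    · rw [hbound i j (by omega), hA.rankCount_eq_zero (by omega)]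
  refine ⟨fun i j hji => ?_, fun i j hi hij hj => ?_, fun i j hi hij hj h₁ h₂ h₃ => ?_⟩
  · by_cases h : 1 ≤ i ∧ j ≤ n
    · rw [hR' i j h.1 h.2, hA.rankCount_eq_zero (.inl hji)]
    · exact hbound i j (by omega)
  · rw [hR' i j hi hj, hR' (i + 1) j (by omega) hj, hR' i (j - 1) hi (by omega)]
    have hr := hA.rankCount_row i j
    have hc := hA.rankCount_col i j (by omega)
    split_ifs at hr hc <;> omega
  · have hmem : (i, j) ∈ A := by
      rw [hR' i j hi hj] at h₁ h₂ h₃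
      rw [hR' (i + 1) j (by omega) hj] at h₁
      rw [hR' i (j - 1) hi (by omega)] at h₂
      rw [hR' (i + 1) (j - 1) (by omega) (by omega)] at h₃
      have hr := hA.rankCount_row i j
      have hr' := hA.rankCount_row i (j - 1)
      by_contra hmem
      split_ifs at hr hr' with h h' <;> try omega
      obtain ⟨k, hk, hik⟩ := h
      obtain rfl | hkj := hk.eq_or_lt
      · exact hmem hik
      · exact h' ⟨k, by omega, hik⟩
    have hrow : ∀ a m, 1 ≤ a → m ≤ n → (¬ ∃ k ≤ m, (a, k) ∈ A) → R a m = R (a + 1) m := by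
      intro a m ha hm h
      rw [hR' a m ha hm, hR' (a + 1) m (by omega) hm, hA.rankCount_row a m, if_neg h, add_zero]
    have hcol : ∀ m b, 1 ≤ m → 1 ≤ b → b ≤ n → (¬ ∃ k ≥ m, (k, b) ∈ A) →
        R m b = R m (b - 1) := by
      intro m b hm hb hbn h
      rw [hR' m b hm hbn, hR' m (b - 1) hm (by omega), hA.rankCount_col m b hb, if_neg h, add_zero]
    refine ⟨⟨fun m hm => ?_, fun m hm hmn => ?_⟩, ⟨fun m hm => ?_, fun m hm hmi => ?_⟩,
      fun m hm hmn => ⟨?_, ?_⟩⟩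
    · refine hrow i m hi (by omega) ?_
      rintro ⟨k, hk, hik⟩
      have := hA.right_unique i j k hmem hik
      omega
    · rw [hR' i m hi hmn, hR' (i + 1) m (by omega) hmn, hA.rankCount_row i m,
        if_pos ⟨j, hm, hmem⟩]
    · refine hcol m j (by omega) (by omega) hj ?_
      rintro ⟨k, hk, hkj⟩
      have := hA.left_unique i k j hmem hkj
      omega
    · rw [hR' m j hm hj, hR' m (j - 1) hm (by omega), hA.rankCount_col m j (by omega),
        if_pos ⟨i, hmi, hmem⟩]
    · refine hrow j m (by omega) hmn ?_
      rintro ⟨k, -, hjk⟩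
      exact hA.not_chain i j k hmem hjk
    · refine hcol m i hm hi (by omega) ?_
      rintro ⟨k, -, hki⟩
      exact hA.not_chain k i j hki hmem

theorem IsRankMatrix.exists_isArcSet {R : ℕ → ℕ → ℕ} (h : IsRankMatrix n R)
    (hbound : ∀ i j : ℕ, (i = 0 ∨ j = 0 ∨ n < i ∨ n < j) → R i j = 0) :
    ∃ A, IsArcSet n A ∧ ∀ i j, 1 ≤ i → j ≤ n → R i j = rankCount A i j := by
  obtain ⟨hzero, hstep, harc⟩ := h
  let A : Finset (ℕ × ℕ) := (Finset.Icc 1 n ×ˢ Finset.Icc 1 n).filter fun x =>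
    x.1 < x.2 ∧ R x.1 x.2 = R (x.1 + 1) x.2 + 1 ∧ R x.1 x.2 = R x.1 (x.2 - 1) + 1 ∧
      R x.1 x.2 = R (x.1 + 1) (x.2 - 1) + 1
  have hmem : ∀ i j, (i, j) ∈ A ↔ 1 ≤ i ∧ i < j ∧ j ≤ n ∧ R i j = R (i + 1) j + 1 ∧
      R i j = R i (j - 1) + 1 ∧ R i j = R (i + 1) (j - 1) + 1 := by
    intro i j
    simp only [A, Finset.mem_filter, Finset.mem_product, Finset.mem_Icc]
    constructor
    · rintro ⟨h, h'⟩
      exact ⟨h.1.1, h'.1, h.2.2, h'.2⟩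
    · rintro ⟨h₁, h₂, h₃, h'⟩
      exact ⟨by omega, h₂, h'⟩
  have hrow : ∀ i j, (i, j) ∈ A → ∀ m ≤ n,
      (m < j → R i m = R (i + 1) m) ∧ (j ≤ m → R i m = R (i + 1) m + 1) := by
    intro i j hij m hm
    obtain ⟨h₁, h₂, h₃, h₄, h₅, h₆⟩ := (hmem i j).1 hij
    obtain ⟨⟨ha, hb⟩, -⟩ := harc i j h₁ h₂ h₃ h₄ h₅ h₆
    exact ⟨ha m, fun h => hb m h hm⟩
  have hcol : ∀ i j, (i, j) ∈ A → ∀ m ≥ 1,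
      (i < m → R m j = R m (j - 1)) ∧ (m ≤ i → R m j = R m (j - 1) + 1) := by
    intro i j hij m hm
    obtain ⟨h₁, h₂, h₃, h₄, h₅, h₆⟩ := (hmem i j).1 hij
    obtain ⟨-, ⟨ha, hb⟩, -⟩ := harc i j h₁ h₂ h₃ h₄ h₅ h₆
    exact ⟨ha m, hb m hm⟩
  have hA : IsArcSet n A := by
    refine ⟨fun a b h => ((hmem a b).1 h).1, fun a b h => ((hmem a b).1 h).2.1,
      fun a b h => ((hmem a b).1 h).2.2.1, fun a b c hb hc => ?_, fun a b c ha hb => ?_,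
      fun a b c hab hbc => ?_⟩
    · have hb' := (hmem a b).1 hb
      have hc' := (hmem a c).1 hc
      have h₁ := hrow a b hb c (by omega)
      have h₂ := hrow a c hc b (by omega)
      omega
    · have ha' := (hmem a c).1 ha
      have hb' := (hmem b c).1 hb
      have h₁ := hcol a c ha b (by omega)
      have h₂ := hcol b c hb a (by omega)
      omega
    · obtain ⟨h₁, h₂, h₃, h₄, h₅, h₆⟩ := (hmem a b).1 hab
      have hbc' := (hmem b c).1 hbc
      have := ((harc a b h₁ h₂ h₃ h₄ h₅ h₆).2.2 c (by omega) (by omega)).1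
      omega
  refine ⟨A, hA, ?_⟩
  have hdiff : ∀ i j, 1 ≤ i → j ≤ n → (∀ k ≤ j, (i, k) ∉ A) → R i j = R (i + 1) j := by
    intro i j hi
    induction j with
    | zero => intro _ _; rw [hzero i 0 (by omega), hzero (i + 1) 0 (by omega)]
    | succ j ih =>
      intro hj hno
      by_cases hij : j + 1 ≤ i
      · rw [hzero i _ hij, hzero (i + 1) _ (by omega)]
      · have ih' := ih (by omega) fun k hk => hno k (by omega)
        have hno' := hno (j + 1) le_rfl
        rw [hmem] at hno'
        simp only [Nat.add_sub_cancel] at hno'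
        have h₁ := hstep i (j + 1) hi (by omega) hj
        have h₂ : R (i + 1) j ≤ R (i + 1) (j + 1) := by
          by_cases h : i = j
          · rw [hzero (i + 1) j (by omega)]
            exact Nat.zero_le _
          · exact (hstep (i + 1) (j + 1) (by omega) (by omega) hj).2.2.1
        simp only [Nat.add_sub_cancel] at h₁
        omega
  intro i j hi hj
  induction hd : n + 1 - i generalizing i with
  | zero => rw [hbound i j (by omega), hA.rankCount_eq_zero (by omega)]
  | succ d ih =>
    rw [hA.rankCount_row i j, ← ih (i + 1) (by omega) (by omega)]
    split_ifs with h
    · obtain ⟨k, hk, hik⟩ := h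
      exact (hrow i k hik j hj).2 hk
    · exact hdiff i j hi hj fun k hk hik => h ⟨k, hk, hik⟩

theorem Rmat_eq_rankCount {σ : Equiv.Perm (Fin n)} {A : Finset (ℕ × ℕ)}
    (hA : ∀ a b, (a, b) ∈ A ↔ ∃ p q : Fin n, p < q ∧ σ p = q ∧ (p : ℕ) + 1 = a ∧ (q : ℕ) + 1 = b)
    (i j : Fin n) : Rmat σ i j = rankCount A (i + 1) (j + 1) := by
  refine Finset.card_nbij (fun x => ((x.1 : ℕ) + 1, (x.2 : ℕ) + 1)) ?_ ?_ ?_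
  · rintro ⟨p, q⟩ hpq
    simp only [arcs, Finset.mem_filter, Finset.mem_univ, true_and, hA, Finset.coe_filter,
      Set.mem_ofPred_eq] at hpq ⊢
    obtain ⟨⟨h₁, h₂⟩, h₃, h₄⟩ := hpq
    exact ⟨⟨p, q, h₁, h₂, rfl, rfl⟩, by simpa using h₃, by simpa using h₄⟩
  · rintro ⟨p, q⟩ - ⟨p', q'⟩ - h
    simp only [Prod.mk.injEq, Nat.add_right_cancel_iff, ← Fin.ext_iff] at h
    rw [h.1, h.2]
  · rintro ⟨a, b⟩ hab
    simp only [Finset.coe_filter, Set.mem_ofPred_eq, hA] at hab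
    obtain ⟨⟨p, q, h₁, h₂, rfl, rfl⟩, h₃, h₄⟩ := hab
    refine ⟨(p, q), ?_, rfl⟩
    simp only [arcs, Finset.coe_filter, Finset.mem_filter, Finset.mem_univ, true_and,
      Set.mem_ofPred_eq]
    exact ⟨⟨h₁, h₂⟩, by simpa using h₃, by simpa using h₄⟩

theorem IsInvol.exists_isArcSet {σ : Equiv.Perm (Fin n)} (hσ : IsInvol σ) :
    ∃ A, IsArcSet n A ∧ ∀ i j : Fin n, Rmat σ i j = rankCount A (i + 1) (j + 1) := by
  let A : Finset (ℕ × ℕ) := (arcs σ).image fun x => ((x.1 : ℕ) + 1, (x.2 : ℕ) + 1)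
  have hA : ∀ a b, (a, b) ∈ A ↔
      ∃ p q : Fin n, p < q ∧ σ p = q ∧ (p : ℕ) + 1 = a ∧ (q : ℕ) + 1 = b := by
    intro a b
    simp [A, arcs, and_assoc]
  refine ⟨A, ?_, Rmat_eq_rankCount hA⟩
  refine ⟨fun a b h => ?_, fun a b h => ?_, fun a b h => ?_, fun a b c hb hc => ?_,
    fun a b c ha hb => ?_, fun a b c hab hbc => ?_⟩
  · obtain ⟨p, q, -, -, rfl, rfl⟩ := (hA a b).1 h
    omega
  · obtain ⟨p, q, hpq, -, rfl, rfl⟩ := (hA a b).1 h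
    omega
  · obtain ⟨p, q, -, -, rfl, rfl⟩ := (hA a b).1 h
    omega
  · obtain ⟨p, q, -, hpq, rfl, rfl⟩ := (hA a b).1 hb
    obtain ⟨p', q', -, hpq', hp, rfl⟩ := (hA _ c).1 hc
    obtain rfl : p' = p := by omega
    rw [← hpq, hpq']
  · obtain ⟨p, q, -, hpq, rfl, rfl⟩ := (hA a c).1 ha
    obtain ⟨p', q', -, hpq', rfl, hq⟩ := (hA b _).1 hb
    obtain rfl : q' = q := by omega
    rw [σ.injective (hpq.trans hpq'.symm)]
  · obtain ⟨p, q, hlt, hpq, rfl, rfl⟩ := (hA a b).1 hab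
    obtain ⟨p', q', hlt', hpq', hp, rfl⟩ := (hA _ c).1 hbc
    obtain rfl : p' = q := by omega
    have : q' = p := by rw [← hpq', ← hpq, hσ]
    omega

open Classical in
theorem IsArcSet.exists_isInvol {A : Finset (ℕ × ℕ)} (hA : IsArcSet n A) :
    ∃ σ : Equiv.Perm (Fin n), IsInvol σ ∧
      ∀ i j : Fin n, Rmat σ i j = rankCount A (i + 1) (j + 1) := by
  let S : Fin n → Fin n → Prop := fun p q =>
    ((p : ℕ) + 1, (q : ℕ) + 1) ∈ A ∨ ((q : ℕ) + 1, (p : ℕ) + 1) ∈ A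
  have hsymm : ∀ p q, S p q → S q p := fun p q h => h.symm
  have huniq : ∀ p q r, S p q → S p r → q = r := by
    rintro p q r (hq | hq) (hr | hr)
    · have := hA.right_unique _ _ _ hq hr
      omega
    · exact absurd hq (hA.not_chain _ _ _ hr)
    · exact absurd hr (hA.not_chain _ _ _ hq)
    · have := hA.left_unique _ _ _ hq hr
      omega
  let f : Fin n → Fin n := fun p => if h : ∃ q, S p q then h.choose else p
  have hf : ∀ p q, S p q → f p = q := by
    intro p q h
    have h' : ∃ q, S p q := ⟨q, h⟩
    simp only [f, dif_pos h']
    exact huniq p _ _ h'.choose_spec h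
  have hf' : ∀ p, (¬ ∃ q, S p q) → f p = p := fun p h => dif_neg h
  have hinv : Function.Involutive f := by
    intro p
    by_cases h : ∃ q, S p q
    · obtain ⟨q, h⟩ := h
      rw [hf p q h, hf q p (hsymm p q h)]
    · rw [hf' p h, hf' p h]
  refine ⟨hinv.toPerm, hinv, Rmat_eq_rankCount fun a b => ⟨fun h => ?_, ?_⟩⟩
  · have h₁ := hA.one_le a b h
    have h₂ := hA.lt a b h
    have h₃ := hA.le a b h
    obtain ⟨a, rfl⟩ := Nat.exists_eq_add_of_le' h₁
    obtain ⟨b, rfl⟩ := Nat.exists_eq_add_of_le' (h₁.trans h₂.le)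
    exact ⟨⟨a, by omega⟩, ⟨b, by omega⟩, by simpa using h₂, hf _ _ (.inl h), rfl, rfl⟩
  · rintro ⟨p, q, hlt, hpq, rfl, rfl⟩
    change f p = q at hpq
    by_cases h : ∃ q, S p q
    · obtain ⟨r, h⟩ := h
      obtain rfl : r = q := (hf p r h).symm.trans hpq
      refine h.resolve_right fun h' => ?_
      have := hA.lt _ _ h'
      omega
    · exact absurd ((hf' p h).symm.trans hpq) hlt.ne

end LinkPat

/-- characterization of the rank matrices of involutions.  The matrix
`R` is indexed by 1-based indices, with the convention (hypothesis `hbound`) that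
entries with an index outside `{1,…,n}` are `0`. -/
theorem rank_matrix_characterization (n : ℕ) (R : ℕ → ℕ → ℕ)
    (hbound : ∀ i j : ℕ, (i = 0 ∨ j = 0 ∨ n < i ∨ n < j) → R i j = 0) :
    (∃ σ : Equiv.Perm (Fin n), LinkPat.IsInvol σ ∧
        ∀ i j : Fin n, R ((i : ℕ) + 1) ((j : ℕ) + 1) = LinkPat.Rmat σ i j)
    ↔
    ((∀ i j : ℕ, j ≤ i → R i j = 0) ∧
     (∀ i j : ℕ, 1 ≤ i → i < j → j ≤ n →
        R (i + 1) j ≤ R i j ∧ R i j ≤ R (i + 1) j + 1 ∧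
        R i (j - 1) ≤ R i j ∧ R i j ≤ R i (j - 1) + 1) ∧
     (∀ i j : ℕ, 1 ≤ i → i < j → j ≤ n →
        R i j = R (i + 1) j + 1 → R i j = R i (j - 1) + 1 →
        R i j = R (i + 1) (j - 1) + 1 →
        ((∀ m, m < j → R i m = R (i + 1) m) ∧
         (∀ m, j ≤ m → m ≤ n → R i m = R (i + 1) m + 1)) ∧
        ((∀ m, i < m → R m j = R m (j - 1)) ∧
         (∀ m, 1 ≤ m → m ≤ i → R m j = R m (j - 1) + 1)) ∧
        (∀ m, 1 ≤ m → m ≤ n → R j m = R (j + 1) m ∧ R m i = R m (i - 1)))) := by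
  refine ⟨?_, fun h => ?_⟩
  · rintro ⟨σ, hσ, hR⟩
    obtain ⟨A, hA, hA'⟩ := hσ.exists_isArcSet
    refine hA.isRankMatrix hbound fun i j hi hin hj hjn => ?_
    obtain ⟨i, rfl⟩ := Nat.exists_eq_add_of_le' hi
    obtain ⟨j, rfl⟩ := Nat.exists_eq_add_of_le' hj
    exact (hR ⟨i, hin⟩ ⟨j, hjn⟩).trans (hA' ⟨i, hin⟩ ⟨j, hjn⟩)
  · obtain ⟨A, hA, hR⟩ := LinkPat.IsRankMatrix.exists_isArcSet h hbound
    obtain ⟨σ, hσ, hσ'⟩ := hA.exists_isInvol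
    exact ⟨σ, hσ, fun i j => (hR _ _ (by omega) (by omega)).trans (hσ' i j).symm⟩
end

section
/- Let σ ∈ S_n² have exactly k arcs. Then c(σ) = 0 and f(σ) = 0 if and only if σ = σ_J for some k-element subset J = {j_1 < ... < j_k} of {1,...,n} satisfying j_s ≥ 2s for all s (necessarily J is then the set of larger endpoints of the arcs of σ). -/
namespace LinkPat

/-- The condition `j_s ≥ 2s` for every element of `J` (`j ∈ J` being the `s`-th
smallest element, `s = #{x ∈ J : x ≤ j}`); points are `1`-based, i.e. the point
corresponding to `j : Fin n` is `(j : ℕ) + 1`. -/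
def JCond {n : ℕ} (J : Finset (Fin n)) : Prop :=
  ∀ j ∈ J, 2 * (J.filter fun x => x ≤ j).card ≤ (j : ℕ) + 1

/-- `σ` is the greedy involution `σ_J` associated to `J`: `σ` is an involution, the
larger endpoints of its arcs are exactly the elements of `J`, and for `j ∈ J` the
partner `σ j` is the largest `d < j` which is neither in `J` nor a partner `σ j'`
of some earlier `j' ∈ J`, `j' < j`. -/
def GreedyInv {n : ℕ} (σ : Equiv.Perm (Fin n)) (J : Finset (Fin n)) : Prop :=
  IsInvol σ ∧ (∀ p : Fin n, σ p < p ↔ p ∈ J) ∧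
  ∀ j ∈ J, ∀ d : Fin n, σ j < d → d < j → d ∈ J ∨ ∃ j' ∈ J, j' < j ∧ σ j' = d

end LinkPat

namespace LinkPat

theorem crossNum_eq_zero_iff {n : ℕ} (σ : Equiv.Perm (Fin n)) :
    crossNum σ = 0 ↔ ∀ i i', i < i' → i' < σ i → ¬ σ i < σ i' := by
  simp only [crossNum, arcs, Finset.card_eq_zero, Finset.filter_eq_empty_iff,
    Finset.mem_product, Finset.mem_filter, Finset.mem_univ, true_and, Prod.forall]
  constructor
  · intro h i i' h₁ h₂ h₃
    exact h i (σ i) i' (σ i') ⟨⟨h₁.trans h₂, rfl⟩, h₂.trans h₃, rfl⟩ ⟨h₁, h₂, h₃⟩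
  · rintro h i _ i' _ ⟨⟨-, rfl⟩, -, rfl⟩ ⟨h₁, h₂, h₃⟩
    exact h i i' h₁ h₂ h₃

theorem fixNum_eq_zero_iff {n : ℕ} (σ : Equiv.Perm (Fin n)) :
    fixNum σ = 0 ↔ ∀ p i, σ p = p → i < p → ¬ p < σ i := by
  simp only [fixNum, arcs, Finset.card_eq_zero, Finset.filter_eq_empty_iff,
    Finset.mem_product, Finset.mem_filter, Finset.mem_univ, true_and, Prod.forall]
  constructor
  · intro h p i hp h₁ h₂
    exact h p i (σ i) ⟨hp, h₁.trans h₂, rfl⟩ ⟨h₁, h₂⟩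
  · rintro h p i _ ⟨hp, -, rfl⟩ ⟨h₁, h₂⟩
    exact h p i hp h₁ h₂

/-- The set of larger endpoints of the arcs of an involution `σ`. -/
def closers {n : ℕ} (σ : Equiv.Perm (Fin n)) : Finset (Fin n) :=
  Finset.univ.filter fun p => σ p < p

theorem mem_closers {n : ℕ} {σ : Equiv.Perm (Fin n)} {p : Fin n} :
    p ∈ closers σ ↔ σ p < p := by
  simp [closers]

theorem card_closers {n : ℕ} {σ : Equiv.Perm (Fin n)} (hσ : IsInvol σ) :
    (closers σ).card = numArcs σ := by
  refine Finset.card_bij (fun p _ => (σ p, p)) ?_ ?_ ?_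
  · intro p hp
    simpa [arcs, hσ p] using mem_closers.1 hp
  · intro p _ q _ h
    exact congrArg Prod.snd h
  · rintro ⟨i, j⟩ h
    obtain ⟨hij, rfl⟩ : i < j ∧ σ i = j := by simpa [arcs] using h
    exact ⟨σ i, mem_closers.2 (by rwa [hσ i]), by rw [hσ i]⟩

theorem jCond_closers {n : ℕ} {σ : Equiv.Perm (Fin n)} (hσ : IsInvol σ) :
    JCond (closers σ) := by
  intro j _
  set A := (closers σ).filter fun x => x ≤ j with hA
  have mem_A : ∀ {x}, x ∈ A ↔ σ x < x ∧ x ≤ j := by simp [hA, mem_closers]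
  have hdisj : Disjoint A (A.image σ) := by
    rw [Finset.disjoint_left]
    intro x hx hx'
    obtain ⟨y, hy, rfl⟩ := Finset.mem_image.1 hx'
    have h := (mem_A.1 hx).1
    rw [hσ y] at h
    exact lt_asymm h (mem_A.1 hy).1
  have hsub : A ∪ A.image σ ⊆ Finset.Iic j := by
    intro x hx
    rcases Finset.mem_union.1 hx with hx | hx
    · exact Finset.mem_Iic.2 (mem_A.1 hx).2
    · obtain ⟨y, hy, rfl⟩ := Finset.mem_image.1 hx
      exact Finset.mem_Iic.2 ((mem_A.1 hy).1.le.trans (mem_A.1 hy).2)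
  have hcard := Finset.card_le_card hsub
  rwa [Finset.card_union_of_disjoint hdisj, Finset.card_image_of_injective _ σ.injective,
    Fin.card_Iic, ← two_mul] at hcard

theorem greedyInv_closers {n : ℕ} {σ : Equiv.Perm (Fin n)} (hσ : IsInvol σ)
    (hc : crossNum σ = 0) (hf : fixNum σ = 0) : GreedyInv σ (closers σ) := by
  rw [crossNum_eq_zero_iff] at hc
  rw [fixNum_eq_zero_iff] at hf
  refine ⟨hσ, fun p => mem_closers.symm, fun j _ d hjd hdj => ?_⟩
  rcases lt_trichotomy (σ d) d with hd | hd | hd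
  · exact Or.inl (mem_closers.2 hd)
  · exact absurd (by rwa [hσ j]) (hf d (σ j) hd hjd)
  · have hle : σ d ≤ j := by
      have := hc (σ j) d hjd (by rwa [hσ j])
      rw [hσ j] at this
      exact not_lt.1 this
    have hne : σ d ≠ j := by
      rintro rfl
      rw [hσ d] at hjd
      exact lt_irrefl _ hjd
    exact Or.inr ⟨σ d, mem_closers.2 (by rwa [hσ d]), lt_of_le_of_ne hle hne, hσ d⟩

theorem GreedyInv.crossNum_eq_zero {n : ℕ} {σ : Equiv.Perm (Fin n)} {J : Finset (Fin n)}
    (h : GreedyInv σ J) : crossNum σ = 0 := by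
  obtain ⟨hσ, hJ, hg⟩ := h
  rw [crossNum_eq_zero_iff]
  intro i i' h₁ h₂ h₃
  rcases hg (σ i) ((hJ _).1 (by rw [hσ i]; exact h₁.trans h₂)) i' (by rwa [hσ i]) h₂ with
    hd | ⟨j', -, hlt, rfl⟩
  · exact lt_asymm ((hJ _).2 hd) (h₂.trans h₃)
  · rw [hσ j'] at h₃
    exact lt_asymm hlt h₃

theorem GreedyInv.fixNum_eq_zero {n : ℕ} {σ : Equiv.Perm (Fin n)} {J : Finset (Fin n)}
    (h : GreedyInv σ J) : fixNum σ = 0 := by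
  obtain ⟨hσ, hJ, hg⟩ := h
  rw [fixNum_eq_zero_iff]
  intro p i hp h₁ h₂
  rcases hg (σ i) ((hJ _).1 (by rw [hσ i]; exact h₁.trans h₂)) p (by rwa [hσ i]) h₂ with
    hd | ⟨j', hj', -, rfl⟩
  · exact ((hJ _).2 hd).ne hp
  · exact ((hJ _).2 hj').ne (σ.injective hp)

end LinkPat

/-- an involution with `k` arcs has no crossings and no fixed points
under arcs iff it is the greedy involution `σ_J` of a `k`-element set `J` whose
`s`-th smallest element is `≥ 2s`. -/
theorem no_crossing_no_fixed_iff_greedy (n k : ℕ) (σ : Equiv.Perm (Fin n))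
    (hσ : LinkPat.IsInvol σ) (hk : LinkPat.numArcs σ = k) :
    (LinkPat.crossNum σ = 0 ∧ LinkPat.fixNum σ = 0) ↔
      ∃ J : Finset (Fin n), J.card = k ∧ LinkPat.JCond J ∧ LinkPat.GreedyInv σ J := by
  constructor
  · rintro ⟨hc, hf⟩
    exact ⟨LinkPat.closers σ, (LinkPat.card_closers hσ).trans hk, LinkPat.jCond_closers hσ,
      LinkPat.greedyInv_closers hσ hc hf⟩
  · rintro ⟨J, -, -, hJ⟩
    exact ⟨hJ.crossNum_eq_zero, hJ.fixNum_eq_zero⟩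
end

section
/- Let σ ∈ S_n² and let (i,j) be an arc of σ. Suppose either: (L) σ has a fixed point p < i; let m be the largest such fixed point, and assume every arc (i',j') of σ with i' < i and j < j' satisfies i' < m; define σ' by replacing the arc (i,j) of σ with (m,j) (so i becomes a fixed point of σ'); or (R) σ has a fixed point p > j; let m be the smallest such fixed point, and assume every arc (i',j') of σ with i' < i and j < j' satisfies j' > m; define σ' by replacing the arc (i,j) of σ with (i,m) (so j becomes a fixed point of σ'). Then in either case σ' ≺ σ and c(σ') + f(σ') = c(σ) + f(σ) + 1. -/
namespace LinkPat

variable {n : ℕ}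

/-- The finite set of fixed points of `σ`. -/
def fixedPts (σ : Equiv.Perm (Fin n)) : Finset (Fin n) := Finset.univ.filter fun p => σ p = p

/-- Indicator that the arcs `x` and `y` cross, with `x` starting first. -/
def crossInd (x y : Fin n × Fin n) : ℕ := if x.1 < y.1 ∧ y.1 < x.2 ∧ x.2 < y.2 then 1 else 0

/-- Indicator that the arc `x` passes over the point `p`. -/
def overInd (p : Fin n) (x : Fin n × Fin n) : ℕ := if x.1 < p ∧ p < x.2 then 1 else 0

lemma crossInd_self (x : Fin n × Fin n) : crossInd x x = 0 := by simp [crossInd]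

lemma crossNum_eq_sum (σ : Equiv.Perm (Fin n)) :
    crossNum σ = ∑ x ∈ arcs σ, ∑ y ∈ arcs σ, crossInd x y := by
  simp only [crossNum, crossInd, Finset.card_filter, Finset.sum_product]

lemma fixNum_eq_sum_s6 (σ : Equiv.Perm (Fin n)) :
    fixNum σ = ∑ p ∈ fixedPts σ, ∑ x ∈ arcs σ, overInd p x := by
  simp only [fixNum, overInd, fixedPts, Finset.card_filter, Finset.sum_product]

lemma crossNum_add_fixNum_of_insert {σ : Equiv.Perm (Fin n)} {A : Finset (Fin n × Fin n)}
    {F : Finset (Fin n)} {u : Fin n × Fin n} {q : Fin n} (hA : arcs σ = insert u A) (hu : u ∉ A)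
    (hF : fixedPts σ = insert q F) (hq : q ∉ F) :
    crossNum σ + fixNum σ = (∑ x ∈ A, (crossInd u x + crossInd x u + overInd q x))
      + ∑ p ∈ F, overInd p u + overInd q u
      + (∑ x ∈ A, ∑ y ∈ A, crossInd x y + ∑ p ∈ F, ∑ x ∈ A, overInd p x) := by
  rw [crossNum_eq_sum, fixNum_eq_sum_s6, hA, hF]
  simp only [Finset.sum_insert hu, Finset.sum_insert hq, Finset.sum_add_distrib, crossInd_self]
  ring

lemma crossNum_add_fixNum_move {σ σ' : Equiv.Perm (Fin n)} {A : Finset (Fin n × Fin n)}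
    {F : Finset (Fin n)} {u u' : Fin n × Fin n} {q q' : Fin n}
    (hA : arcs σ = insert u A) (hu : u ∉ A) (hF : fixedPts σ = insert q F) (hq : q ∉ F)
    (hA' : arcs σ' = insert u' A) (hu' : u' ∉ A) (hF' : fixedPts σ' = insert q' F) (hq' : q' ∉ F)
    (hterm : ∀ x ∈ A, crossInd u' x + crossInd x u' + overInd q' x
      = crossInd u x + crossInd x u + overInd q x)
    (hfix : ∀ p ∈ F, overInd p u' = overInd p u) (hover : overInd q' u' = overInd q u + 1) :
    crossNum σ' + fixNum σ' = crossNum σ + fixNum σ + 1 := by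
  rw [crossNum_add_fixNum_of_insert hA hu hF hq, crossNum_add_fixNum_of_insert hA' hu' hF' hq',
    Finset.sum_congr rfl hterm, Finset.sum_congr rfl hfix, hover]
  ring

lemma rle_of_insert {σ σ' : Equiv.Perm (Fin n)} {A : Finset (Fin n × Fin n)} {u u' : Fin n × Fin n}
    (hA : arcs σ = insert u A) (hu : u ∉ A) (hA' : arcs σ' = insert u' A) (hu' : u' ∉ A)
    (h₁ : u'.1 ≤ u.1) (h₂ : u.2 ≤ u'.2) : rle σ' σ := by
  intro a b
  simp only [Rmat, Finset.card_filter, hA, hA', Finset.sum_insert hu, Finset.sum_insert hu']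
  gcongr
  split_ifs <;> omega

/-- The values of the conjugate of an involution by the transposition of a fixed point `q` and a
non-fixed point `q'`. -/
lemma conj_swap_apply {σ : Equiv.Perm (Fin n)} (hσ : IsInvol σ) {q q' : Fin n} (hq : σ q = q)
    (hq' : σ q' ≠ q') (x : Fin n) :
    (Equiv.swap q' q * σ * Equiv.swap q' q) x
      = if x = q then σ q' else if x = q' then q' else if x = σ q' then q else σ x := by
  have h := hσ q'
  have h' := hσ x
  simp only [Equiv.Perm.mul_apply, Equiv.swap_apply_def]
  grind

lemma mem_arcs {σ : Equiv.Perm (Fin n)} {x : Fin n × Fin n} :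
    x ∈ arcs σ ↔ x.1 < x.2 ∧ σ x.1 = x.2 := by simp [arcs]

lemma mem_fixedPts {σ : Equiv.Perm (Fin n)} {p : Fin n} : p ∈ fixedPts σ ↔ σ p = p := by
  simp [fixedPts]

lemma fixedPts_conj_swap {σ : Equiv.Perm (Fin n)} (hσ : IsInvol σ) {q q' : Fin n} (hq : σ q = q)
    (hq' : σ q' ≠ q') :
    fixedPts (Equiv.swap q' q * σ * Equiv.swap q' q) = insert q' ((fixedPts σ).erase q) := by
  ext p
  have h := hσ q'
  simp only [mem_fixedPts, conj_swap_apply hσ hq hq', Finset.mem_insert, Finset.mem_erase]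
  grind

lemma arcs_conj_swap_left {σ : Equiv.Perm (Fin n)} (hσ : IsInvol σ) {i j m : Fin n}
    (harc : IsArc σ i j) (hm : σ m = m) (hmi : m < i) :
    arcs (Equiv.swap i m * σ * Equiv.swap i m) = insert (m, j) ((arcs σ).erase (i, j)) := by
  obtain ⟨hij, rfl⟩ := harc
  ext ⟨a, b⟩
  have h := hσ i
  have ha := hσ a
  simp only [mem_arcs, conj_swap_apply hσ hm hij.ne', Finset.mem_insert, Finset.mem_erase,
    Prod.mk.injEq, ne_eq]
  grind

lemma arcs_conj_swap_right {σ : Equiv.Perm (Fin n)} (hσ : IsInvol σ) {i j m : Fin n}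
    (harc : IsArc σ i j) (hm : σ m = m) (hjm : j < m) :
    arcs (Equiv.swap j m * σ * Equiv.swap j m) = insert (i, m) ((arcs σ).erase (i, j)) := by
  obtain ⟨hij, rfl⟩ := harc
  ext ⟨a, b⟩
  have h := hσ i
  have ha := hσ a
  have hne : σ (σ i) ≠ σ i := by rw [h]; exact hij.ne
  simp only [mem_arcs, conj_swap_apply hσ hm hne, Finset.mem_insert, Finset.mem_erase,
    Prod.mk.injEq, ne_eq]
  grind

end LinkPat

open LinkPat in
/-- moving an endpoint of an arc to the nearest fixed point (on the
left or on the right) produces a strictly smaller involution with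
`c + f` increased by exactly `1`.  The new involution `σ'` (replacing the arc
`(i,j)` by `(m,j)`, resp. by `(i,m)`) is the conjugate of `σ` by the transposition
exchanging `i` and `m` (resp. `j` and `m`). -/
theorem endpoint_move (n : ℕ) (σ σ' : Equiv.Perm (Fin n))
    (hσ : LinkPat.IsInvol σ) (i j : Fin n) (harc : LinkPat.IsArc σ i j)
    (hcase :
      (∃ m : Fin n, σ m = m ∧ m < i ∧ (∀ p : Fin n, σ p = p → p < i → p ≤ m) ∧
        (∀ a b : Fin n, LinkPat.IsArc σ a b → a < i → j < b → a < m) ∧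
        σ' = Equiv.swap i m * σ * Equiv.swap i m) ∨
      (∃ m : Fin n, σ m = m ∧ j < m ∧ (∀ p : Fin n, σ p = p → j < p → m ≤ p) ∧
        (∀ a b : Fin n, LinkPat.IsArc σ a b → a < i → j < b → m < b) ∧
        σ' = Equiv.swap j m * σ * Equiv.swap j m)) :
    LinkPat.rlt σ' σ ∧
      LinkPat.crossNum σ' + LinkPat.fixNum σ' = LinkPat.crossNum σ + LinkPat.fixNum σ + 1 := by
  have hji : σ j = i := by rw [← harc.2]; exact hσ i
  obtain ⟨hij, hσij⟩ := id harc
  have hmem : (i, j) ∈ arcs σ := mem_arcs.2 harc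
  have hA : arcs σ = insert (i, j) ((arcs σ).erase (i, j)) := (Finset.insert_erase hmem).symm
  have hu : (i, j) ∉ (arcs σ).erase (i, j) := Finset.notMem_erase _ _
  rcases hcase with ⟨m, hm, hlt, hmax, hnest, rfl⟩ | ⟨m, hm, hlt, hmin, hnest, rfl⟩
  · have hne : σ i ≠ i := harc.2 ▸ hij.ne'
    have hF : fixedPts σ = insert m ((fixedPts σ).erase m) :=
      (Finset.insert_erase (mem_fixedPts.2 hm)).symm
    have hA' := arcs_conj_swap_left hσ harc hm hlt
    have hF' := fixedPts_conj_swap hσ hm hne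
    have hu' : (m, j) ∉ (arcs σ).erase (i, j) := by
      simp only [Finset.mem_erase, mem_arcs]; grind
    refine ⟨⟨rle_of_insert hA hu hA' hu' hlt.le le_rfl, fun h => ?_⟩,
      crossNum_add_fixNum_move hA hu hF (Finset.notMem_erase _ _) hA' hu' hF' ?_ ?_ ?_ ?_⟩
    · have := congrArg (· i) h
      simp only [conj_swap_apply hσ hm hne] at this
      grind
    · simp [mem_fixedPts, hne]
    · rintro ⟨a, b⟩ hx
      simp only [Finset.mem_erase, mem_arcs, ne_eq, Prod.mk.injEq] at hx
      obtain ⟨hx, hab, hσab⟩ := hx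
      have := hnest a b ⟨hab, hσab⟩
      have hba : σ b = a := by rw [← hσab]; exact hσ a
      have h₁ : a ≠ m ∧ a ≠ i ∧ a ≠ j ∧ b ≠ m ∧ b ≠ i ∧ b ≠ j := by grind
      simp only [crossInd, overInd]
      split_ifs <;> first | rfl | omega
    · intro p hp
      simp only [Finset.mem_erase, mem_fixedPts] at hp
      have := hmax p hp.2
      have h₁ : p ≠ i := by grind
      simp only [overInd]
      split_ifs <;> first | rfl | omega
    · simp [overInd, hlt, hij, hlt.le]
  · have hne : σ j ≠ j := hji ▸ hij.ne
    have hF : fixedPts σ = insert m ((fixedPts σ).erase m) :=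
      (Finset.insert_erase (mem_fixedPts.2 hm)).symm
    have hA' := arcs_conj_swap_right hσ harc hm hlt
    have hF' := fixedPts_conj_swap hσ hm hne
    have hu' : (i, m) ∉ (arcs σ).erase (i, j) := by
      simp only [Finset.mem_erase, mem_arcs]; grind
    refine ⟨⟨rle_of_insert hA hu hA' hu' le_rfl hlt.le, fun h => ?_⟩,
      crossNum_add_fixNum_move hA hu hF (Finset.notMem_erase _ _) hA' hu' hF' ?_ ?_ ?_ ?_⟩
    · have := congrArg (· j) h
      simp only [conj_swap_apply hσ hm hne] at this
      grind
    · simp [mem_fixedPts, hne]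
    · rintro ⟨a, b⟩ hx
      simp only [Finset.mem_erase, mem_arcs, ne_eq, Prod.mk.injEq] at hx
      obtain ⟨hx, hab, hσab⟩ := hx
      have := hnest a b ⟨hab, hσab⟩
      have hba : σ b = a := by rw [← hσab]; exact hσ a
      have h₁ : a ≠ m ∧ a ≠ i ∧ a ≠ j ∧ b ≠ m ∧ b ≠ i ∧ b ≠ j := by grind
      simp only [crossInd, overInd]
      split_ifs <;> first | rfl | omega
    · intro p hp
      simp only [Finset.mem_erase, mem_fixedPts] at hp
      have := hmin p hp.2
      have h₁ : p ≠ j := by grind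
      simp only [overInd]
      split_ifs <;> first | rfl | omega
    · simp [overInd, hlt, hij, hlt.le]
end

section
/- Let σ ∈ S_n² and let (i,j) be an external arc of σ such that some fixed point p of σ satisfies p < i or p > j (that is, (i,j) ∈ E(σ) but (i,j) ∉ E_max(σ)). Then σ⁻_{(i,j)} is not covered by σ with respect to ⪯: there exists τ ∈ S_n² with σ⁻_{(i,j)} ≺ τ ≺ σ. -/
namespace LinkPat

/-- `σ⁻_{(i,j)}`: the involution obtained from `σ` by deleting the arc `(i,j)`
(making `i` and `j` fixed points). -/
def delArc {n : ℕ} (σ : Equiv.Perm (Fin n)) (i j : Fin n) : Equiv.Perm (Fin n) :=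
  σ * Equiv.swap i j

end LinkPat

namespace LinkPat

variable {n : ℕ}

/-- Multiplying `ρ` by the transposition of two of its fixed points evaluates casewise. -/
lemma mul_swap_apply_of_fixed {ρ : Equiv.Perm (Fin n)} {u v : Fin n} (hu : ρ u = u)
    (hv : ρ v = v) (x : Fin n) :
    (ρ * Equiv.swap u v) x = if x = u then v else if x = v then u else ρ x := by
  rw [Equiv.Perm.mul_apply, Equiv.swap_apply_def]
  split_ifs <;> first | assumption | rfl

lemma IsInvol.mul_swap {ρ : Equiv.Perm (Fin n)} (hρ : IsInvol ρ) {u v : Fin n}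
    (hu : ρ u = u) (hv : ρ v = v) : IsInvol (ρ * Equiv.swap u v) := by
  intro x
  have := hρ x
  simp only [mul_swap_apply_of_fixed hu hv]
  grind

/-- Joining two fixed points adds exactly one arc. -/
lemma arcs_mul_swap {ρ : Equiv.Perm (Fin n)} {u v : Fin n} (hu : ρ u = u) (hv : ρ v = v)
    (huv : u < v) : arcs (ρ * Equiv.swap u v) = insert (u, v) (arcs ρ) := by
  ext ⟨a, b⟩
  simp only [arcs, Finset.mem_filter, Finset.mem_univ, true_and, Finset.mem_insert,
    Prod.mk.injEq, mul_swap_apply_of_fixed hu hv]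
  grind

lemma Rmat_mul_swap {ρ : Equiv.Perm (Fin n)} {u v : Fin n} (hu : ρ u = u) (hv : ρ v = v)
    (huv : u < v) (a b : Fin n) :
    Rmat (ρ * Equiv.swap u v) a b = Rmat ρ a b + if a ≤ u ∧ v ≤ b then 1 else 0 := by
  have hnot : (u, v) ∉ arcs ρ := by
    simp [arcs, hu, huv.ne]
  rw [Rmat, arcs_mul_swap hu hv huv, Finset.filter_insert]
  split_ifs with h
  · rw [Finset.card_insert_of_notMem (fun hm => hnot (Finset.mem_filter.1 hm).1), Rmat]
  · rfl

/-- Joining two fixed points strictly increases the involution. -/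
lemma rlt_mul_swap {ρ : Equiv.Perm (Fin n)} {u v : Fin n} (hu : ρ u = u) (hv : ρ v = v)
    (huv : u < v) : rlt ρ (ρ * Equiv.swap u v) := by
  refine ⟨fun a b => ?_, fun h => huv.ne ?_⟩
  · rw [Rmat_mul_swap hu hv huv]
    exact Nat.le_add_right _ _
  · simpa [hu, hv] using congrArg (fun π => π u) h

/-- Joining a pair of fixed points nested inside another pair gives a larger involution. -/
lemma rle_mul_swap_of_nested {ρ : Equiv.Perm (Fin n)} {u v u' v' : Fin n} (hu : ρ u = u)
    (hv : ρ v = v) (hu' : ρ u' = u') (hv' : ρ v' = v') (huu : u ≤ u') (huv : u' < v')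
    (hvv : v' ≤ v) : rle (ρ * Equiv.swap u v) (ρ * Equiv.swap u' v') := by
  intro a b
  rw [Rmat_mul_swap hu hv (huu.trans_lt (huv.trans_le hvv)), Rmat_mul_swap hu' hv' huv]
  grind

end LinkPat

/-- if `(i,j)` is an external arc of `σ` which is not in `E_max(σ)`
(some fixed point lies outside of it), then `σ⁻_{(i,j)}` is not covered by `σ`:
there is an involution `τ` strictly between them. -/
theorem delete_external_not_cover (n : ℕ) (σ : Equiv.Perm (Fin n))
    (hσ : LinkPat.IsInvol σ) (i j : Fin n) (harc : LinkPat.IsArc σ i j)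
    (hext : ∀ a b : Fin n, LinkPat.IsArc σ a b → ¬(a < i ∧ j < b))
    (hfixout : ∃ p : Fin n, σ p = p ∧ (p < i ∨ j < p)) :
    ∃ τ : Equiv.Perm (Fin n), LinkPat.IsInvol τ ∧
      LinkPat.rlt (LinkPat.delArc σ i j) τ ∧ LinkPat.rlt τ σ := by
  obtain ⟨p, hp, hpout⟩ := hfixout
  obtain ⟨hij, hσi⟩ := harc
  have hσj : σ j = i := hσi ▸ hσ i
  set ρ := LinkPat.delArc σ i j with hρ
  have hρσ : ρ * Equiv.swap i j = σ := by simp [hρ, LinkPat.delArc, mul_assoc]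
  have hρi : ρ i = i := by simp [hρ, LinkPat.delArc, hσj]
  have hρj : ρ j = j := by simp [hρ, LinkPat.delArc, hσi]
  have hρp : ρ p = p := by
    have hpi : p ≠ i := by rintro rfl; exact hij.ne (hp.symm.trans hσi)
    have hpj : p ≠ j := by rintro rfl; exact hij.ne (hσj.symm.trans hp)
    simp [hρ, LinkPat.delArc, Equiv.swap_apply_of_ne_of_ne hpi hpj, hp]
  have hρinv : LinkPat.IsInvol ρ := by
    intro x
    have := hσ x
    simp only [hρ, LinkPat.delArc, Equiv.Perm.mul_apply, Equiv.swap_apply_def]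
    grind
  rcases hpout with hpi | hjp
  · refine ⟨ρ * Equiv.swap p j, hρinv.mul_swap hρp hρj,
      LinkPat.rlt_mul_swap hρp hρj (hpi.trans hij), ?_, fun h => ?_⟩
    · exact hρσ ▸ LinkPat.rle_mul_swap_of_nested hρp hρj hρi hρj hpi.le hij le_rfl
    · have : j = p := by simpa [hρj, hp] using congrArg (fun π => π p) h
      exact (hpi.trans hij).ne' this
  · refine ⟨ρ * Equiv.swap i p, hρinv.mul_swap hρi hρp,
      LinkPat.rlt_mul_swap hρi hρp (hij.trans hjp), ?_, fun h => ?_⟩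
    · exact hρσ ▸ LinkPat.rle_mul_swap_of_nested hρi hρp hρi hρj le_rfl hij hjp.le
    · have : i = p := by simpa [hρi, hp] using congrArg (fun π => π p) h
      exact (hij.trans hjp).ne this
end

section
/- Let σ ∈ S_n²(k) with k ≤ n/2 − 1, and let m be an integer with k < m ≤ n/2. Then the set F_m(σ) := {τ ∈ S_n²(m) : σ ≺ τ} is nonempty and has a minimum element with respect to ⪯: there exists σ̄_m ∈ F_m(σ) such that σ̄_m ⪯ τ for every τ ∈ F_m(σ). -/
namespace LinkPat

variable {n : ℕ}

/-- The number of arcs of `σ` inside the half-open interval `[i, j)`. -/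
def arcCount (σ : Equiv.Perm (Fin n)) (i j : ℕ) : ℕ :=
  ((arcs σ).filter fun a => i ≤ a.1.val ∧ a.2.val < j).card

theorem Rmat_eq_arcCount (σ : Equiv.Perm (Fin n)) (i j : Fin n) :
    Rmat σ i j = arcCount σ i (j + 1) := by
  simp only [Rmat, arcCount, Nat.lt_succ_iff, Fin.val_fin_le]

theorem numArcs_eq_arcCount (σ : Equiv.Perm (Fin n)) : numArcs σ = arcCount σ 0 n := by
  simp [numArcs, arcCount]

theorem arcCount_of_le (σ : Equiv.Perm (Fin n)) {i j : ℕ} (h : j ≤ i + 1) :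
    arcCount σ i j = 0 := by
  simp only [arcCount, arcs, Finset.card_eq_zero, Finset.filter_eq_empty_iff, Finset.mem_filter]
  rintro ⟨a, b⟩ ⟨-, hab, -⟩ ⟨h1, h2⟩
  simp only [Fin.lt_def] at *
  omega

theorem arcCount_of_left_ge (σ : Equiv.Perm (Fin n)) {i : ℕ} (j : ℕ) (h : n ≤ i) :
    arcCount σ i j = 0 := by
  simp only [arcCount, Finset.card_eq_zero, Finset.filter_eq_empty_iff]
  rintro ⟨a, b⟩ - ⟨h1, -⟩
  have := a.isLt
  simp only at h1
  omega

theorem arcCount_left_step (σ : Equiv.Perm (Fin n)) (p : Fin n) (j : ℕ) :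
    arcCount σ p j = arcCount σ (p + 1) j + if p < σ p ∧ (σ p).val < j then 1 else 0 := by
  have key : (arcs σ).filter (fun a => p.val ≤ a.1.val ∧ a.2.val < j) =
      (arcs σ).filter (fun a => p.val + 1 ≤ a.1.val ∧ a.2.val < j) ∪
        (if p < σ p ∧ (σ p).val < j then {(p, σ p)} else ∅) := by
    ext ⟨a, b⟩
    rcases eq_or_ne a p with rfl | hne
    · split_ifs with h <;> simp [arcs] <;> grind
    · have : a.val ≠ p.val := fun h => hne (Fin.ext h)
      split_ifs with h <;> simp [arcs, hne] <;> omega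
  unfold arcCount
  rw [key, Finset.card_union_of_disjoint]
  · split_ifs <;> simp
  · split_ifs <;> simp

theorem arcCount_right_step {σ : Equiv.Perm (Fin n)} (hσ : IsInvol σ) (i : ℕ) (p : Fin n) :
    arcCount σ i (p + 1) = arcCount σ i p + if σ p < p ∧ i ≤ (σ p).val then 1 else 0 := by
  have key : (arcs σ).filter (fun a => i ≤ a.1.val ∧ a.2.val < p.val + 1) =
      (arcs σ).filter (fun a => i ≤ a.1.val ∧ a.2.val < p.val) ∪
        (if σ p < p ∧ i ≤ (σ p).val then {(σ p, p)} else ∅) := by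
    ext ⟨a, b⟩
    rcases eq_or_ne b p with rfl | hne
    · have := hσ a
      have := hσ b
      split_ifs with h <;> simp [arcs] <;> grind
    · have : b.val ≠ p.val := fun h => hne (Fin.ext h)
      split_ifs with h <;> simp [arcs, hne] <;> omega
  unfold arcCount
  rw [key, Finset.card_union_of_disjoint]
  · split_ifs <;> simp
  · split_ifs <;> simp

/-- Arcs inside the disjoint intervals `[0, i)` and `[i + 1, n)` are distinct. -/
theorem arcCount_add_le (σ : Equiv.Perm (Fin n)) (i : ℕ) :
    arcCount σ 0 i + arcCount σ (i + 1) n ≤ numArcs σ := by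
  unfold arcCount numArcs
  rw [← Finset.card_union_of_disjoint]
  · exact Finset.card_le_card (Finset.union_subset (Finset.filter_subset _ _)
      (Finset.filter_subset _ _))
  · rw [Finset.disjoint_left]
    rintro ⟨a, b⟩ h1 h2
    simp only [arcs, Finset.mem_filter, Fin.lt_def] at h1 h2
    omega

/-- A function on `{0, …, n}` that increases at each step is monotone. -/
theorem le_of_step_le {n : ℕ} {f : ℕ → ℤ} (hf : ∀ p : Fin n, f p ≤ f (p + 1)) {a b : ℕ}
    (hab : a ≤ b) (hb : b ≤ n) : f a ≤ f b := by
  induction b, hab using Nat.le_induction with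
  | base => exact le_rfl
  | succ b _ ih => exact (ih (by omega)).trans (hf ⟨b, by omega⟩)

/-- The bound on `arcCount τ i j` obtained from the total number of arcs by discarding the arcs
which leave `[i, j)`. -/
theorem numArcs_le_arcCount {τ : Equiv.Perm (Fin n)} (hτ : IsInvol τ) {i j : ℕ}
    (hi : i ≤ n) (hj : j ≤ n) :
    (numArcs τ : ℤ) ≤ arcCount τ i j + (i - arcCount τ 0 i) + (n - j - arcCount τ j n) := by
  have h1 := le_of_step_le (n := n) (f := fun x => (arcCount τ x n : ℤ) + (x - arcCount τ 0 x))
    (fun p => by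
      have a := arcCount_left_step τ p n
      have b := arcCount_right_step hτ 0 p
      simp only [Fin.lt_def] at a b
      push_cast
      split_ifs at a b <;> omega) (Nat.zero_le i) hi
  have h2 := le_of_step_le (n := n) (f := fun x => (x + arcCount τ x n : ℤ) - arcCount τ i x)
    (fun p => by
      have a := arcCount_left_step τ p n
      have b := arcCount_right_step hτ i p
      simp only [Fin.lt_def] at a b
      push_cast
      split_ifs at a b <;> omega) hj le_rfl
  have h3 := arcCount_of_le τ (i := 0) (j := 0) (by omega)
  have h4 := arcCount_of_left_ge τ n le_rfl
  rw [numArcs_eq_arcCount]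
  simp only [Nat.cast_zero] at h1 h2
  omega

theorem arcCount_le_of_rle {σ τ : Equiv.Perm (Fin n)} (h : rle σ τ) {i j : ℕ} (hj : j ≤ n) :
    arcCount σ i j ≤ arcCount τ i j := by
  rcases Nat.eq_zero_or_pos j with rfl | hj0
  · simp [arcCount_of_le σ (Nat.zero_le (i + 1))]
  rcases le_or_gt n i with hi | hi
  · simp [arcCount_of_left_ge σ j hi]
  have := h ⟨i, hi⟩ ⟨j - 1, by omega⟩
  rw [Rmat_eq_arcCount, Rmat_eq_arcCount] at this
  simpa [Nat.sub_add_cancel hj0] using this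

/-- A partial matching of `Fin n` is the set of arcs of an involution. -/
theorem exists_invol_of_matching (P : Fin n → Fin n → Prop) (hlt : ∀ i j, P i j → i < j)
    (hr : ∀ i j j', P i j → P i j' → j = j') (hl : ∀ i i' j, P i j → P i' j → i = i')
    (hlr : ∀ i j l, P i j → ¬ P j l) :
    ∃ τ : Equiv.Perm (Fin n), IsInvol τ ∧ ∀ i j, P i j ↔ i < j ∧ τ i = j := by
  classical
  let f : Fin n → Fin n := fun p => if h : ∃ q, P p q ∨ P q p then h.choose else p
  have hf : ∀ p q, (P p q ∨ P q p) → f p = q := by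
    intro p q h
    have hex : ∃ q, P p q ∨ P q p := ⟨q, h⟩
    have hs := hex.choose_spec
    simp only [f, dif_pos hex]
    grind
  have hf' : ∀ p, (¬ ∃ q, P p q ∨ P q p) → f p = p := fun p h => by simp only [f, dif_neg h]
  have hinv : Function.Involutive f := by
    intro p
    by_cases h : ∃ q, P p q ∨ P q p
    · obtain ⟨q, hq⟩ := h
      rw [hf p q hq, hf q p hq.symm]
    · rw [hf' p h, hf' p h]
  refine ⟨hinv.toPerm, hinv, fun i j => ⟨fun h => ⟨hlt i j h, hf i j (Or.inl h)⟩, ?_⟩⟩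
  rintro ⟨hij, h⟩
  rw [Function.Involutive.coe_toPerm] at h
  by_cases hex : ∃ q, P i q ∨ P q i
  · obtain ⟨q, hq⟩ := hex
    have := hf i q hq
    grind
  · rw [hf' i hex] at h
    exact absurd hij (by simp [h])

/-- A function with the formal properties of a rank matrix is the rank matrix of an involution. -/
theorem exists_invol_arcCount_eq (F : ℕ → ℕ → ℤ)
    (hzero : ∀ i j, i ≤ n → j ≤ n → j ≤ i + 1 → F i j = 0)
    (hrow : ∀ (i : Fin n) (j : ℕ), j ≤ n → F (i + 1) j ≤ F i j ∧ F i j ≤ F (i + 1) j + 1)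
    (hcol : ∀ (i : ℕ) (j : Fin n), i ≤ n → F i j ≤ F i (j + 1) ∧ F i (j + 1) ≤ F i j + 1)
    (hmix : ∀ i j : Fin n,
      F (i + 1) (j + 1) - F (i + 1) j ≤ F i (j + 1) - F i j)
    (hends : ∀ p : Fin n, F 0 (p + 1) - F 0 p + (F p n - F (p + 1) n) ≤ 1) :
    ∃ τ : Equiv.Perm (Fin n), IsInvol τ ∧
      ∀ i j, i ≤ n → j ≤ n → (arcCount τ i j : ℤ) = F i j := by
  have hrowMono (i : Fin n) {a b : ℕ} (hab : a ≤ b) (hb : b ≤ n) :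
      F i a - F (i + 1) a ≤ F i b - F (i + 1) b :=
    le_of_step_le (f := fun x => F i x - F (i + 1) x)
      (fun p => by have := hmix i p; omega) hab hb
  have hcolAnti (j : Fin n) {a b : ℕ} (hab : a ≤ b) (hb : b ≤ n) :
      F b (j + 1) - F b j ≤ F a (j + 1) - F a j := by
    have := le_of_step_le (f := fun x => F x j - F x (j + 1))
      (fun p => by have := hmix p j; omega) hab hb
    omega
  obtain ⟨τ, hτ, hP⟩ := exists_invol_of_matching
    (fun i j : Fin n => F i (j + 1) - F i j = F (i + 1) (j + 1) - F (i + 1) j + 1)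
    (fun i j h => by
      by_contra hij
      rw [Fin.lt_def] at hij
      have h1 := hzero i (j + 1) i.isLt.le j.isLt (by omega)
      have h2 := hzero i j i.isLt.le j.isLt.le (by omega)
      have h3 := hzero (i + 1) (j + 1) i.isLt j.isLt (by omega)
      have h4 := hzero (i + 1) j i.isLt j.isLt.le (by omega)
      omega)
    (fun i j j' h h' => by
      by_contra hne
      have hne' : j.val ≠ j'.val := fun h => hne (Fin.ext h)
      rcases Nat.lt_or_gt_of_ne hne' with hl | hl
      · have h1 := hrowMono i (a := j + 1) (b := j') (by omega) j'.isLt.le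
        have h2 := hrow i j j.isLt.le
        have h3 := hrow i (j' + 1) j'.isLt
        omega
      · have h1 := hrowMono i (a := j' + 1) (b := j) (by omega) j.isLt.le
        have h2 := hrow i j' j'.isLt.le
        have h3 := hrow i (j + 1) j.isLt
        omega)
    (fun i i' j h h' => by
      by_contra hne
      have hne' : i.val ≠ i'.val := fun h => hne (Fin.ext h)
      rcases Nat.lt_or_gt_of_ne hne' with hl | hl
      · have h1 := hcolAnti j (a := i + 1) (b := i') (by omega) i'.isLt.le
        have h2 := hcol i j i.isLt.le
        have h3 := hcol (i' + 1) j i'.isLt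
        omega
      · have h1 := hcolAnti j (a := i' + 1) (b := i) (by omega) i.isLt.le
        have h2 := hcol i' j i'.isLt.le
        have h3 := hcol (i + 1) j i.isLt
        omega)
    (fun i j l h h' => by
      have h1 := hcolAnti j (Nat.zero_le i) i.isLt.le
      have h2 := hcol (i + 1) j i.isLt
      have h3 := hrowMono j (a := l + 1) (b := n) l.isLt le_rfl
      have h4 := hrow j l l.isLt.le
      have h5 := hends j
      omega)
  refine ⟨τ, hτ, fun i j hi hj => ?_⟩
  induction j with
  | zero => rw [arcCount_of_le τ (by omega), hzero i 0 hi hj (by omega)]; rfl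
  | succ j ih =>
    have hstep : ∀ i, i ≤ n → F i (j + 1) - F i j =
        if τ ⟨j, hj⟩ < ⟨j, hj⟩ ∧ i ≤ (τ ⟨j, hj⟩).val then 1 else 0 := by
      intro i hi
      induction hi using Nat.decreasingInduction with
      | self =>
        rw [hzero n (j + 1) le_rfl hj (by omega), hzero n j le_rfl (by omega) (by omega),
          if_neg (by have := (τ ⟨j, hj⟩).isLt; omega)]
        rfl
      | of_succ i hi ih =>
        have h1 := hP ⟨i, hi⟩ ⟨j, hj⟩
        have h2 := hmix ⟨i, hi⟩ ⟨j, hj⟩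
        have h3 := hcol i ⟨j, hj⟩ hi.le
        have h4 := hcol (i + 1) ⟨j, hj⟩ hi
        have h5 : τ ⟨i, hi⟩ = ⟨j, hj⟩ ↔ (τ ⟨j, hj⟩).val = i := by
          constructor
          · intro h
            rw [← h, hτ]
          · intro h
            rw [← hτ ⟨j, hj⟩]
            congr 1
            exact Fin.ext h.symm
        rw [h5] at h1
        simp only [Fin.lt_def] at *
        split_ifs at ih ⊢ <;> omega
    have h1 := hstep i hi
    have h2 := arcCount_right_step hτ i ⟨j, hj⟩
    have h3 := ih (by omega)
    simp only at h2
    rw [h2]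
    push_cast
    omega

/-- The entries of the minimal rank matrix above `σ` with total number of arcs `m`. -/
def minRank (σ : Equiv.Perm (Fin n)) (m i j : ℕ) : ℤ :=
  max (arcCount σ i j : ℤ) (m - (i - arcCount σ 0 i) - (n - j - arcCount σ j n))

theorem exists_invol_arcCount_eq_minRank {σ : Equiv.Perm (Fin n)} (hσ : IsInvol σ) {m : ℕ}
    (hm : numArcs σ < m) (hmn : 2 * m ≤ n) :
    ∃ τ : Equiv.Perm (Fin n), IsInvol τ ∧
      ∀ i j, i ≤ n → j ≤ n → (arcCount τ i j : ℤ) = minRank σ m i j := by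
  apply exists_invol_arcCount_eq
  · intro i j hi hj hij
    have h1 := arcCount_add_le σ i
    have h2 := arcCount_of_le σ hij
    have h3 : (j + arcCount σ j n : ℤ) ≤ (i + 1 : ℕ) + arcCount σ (i + 1) n := by
      rcases hi.eq_or_lt with rfl | hi
      · have := le_of_step_le (n := i) (f := fun x => (x + arcCount σ x i : ℤ))
          (fun p => by
            have a := arcCount_left_step σ p i
            push_cast
            split_ifs at a <;> omega) hj le_rfl
        have h4 := arcCount_of_left_ge σ i le_rfl
        push_cast
        omega
      · exact le_of_step_le (n := n) (f := fun x => (x + arcCount σ x n : ℤ))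
          (fun p => by
            have a := arcCount_left_step σ p n
            push_cast
            split_ifs at a <;> omega) hij hi
    unfold minRank
    omega
  · intro i j _
    have a := arcCount_left_step σ i j
    have b := arcCount_right_step hσ 0 i
    simp only [Fin.lt_def] at a b
    unfold minRank
    push_cast
    split_ifs at a b <;> omega
  · intro i j _
    have a := arcCount_left_step σ j n
    have b := arcCount_right_step hσ i j
    simp only [Fin.lt_def] at a b
    unfold minRank
    push_cast
    split_ifs at a b <;> omega
  · intro i j
    have a := arcCount_left_step σ i j
    have b := arcCount_left_step σ i (j + 1)
    have c := arcCount_right_step hσ i j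
    have d := arcCount_right_step hσ (i + 1) j
    have e := arcCount_right_step hσ 0 i
    have f := arcCount_left_step σ j n
    simp only [Fin.lt_def] at a b c d e f
    unfold minRank
    push_cast
    split_ifs at a b e f <;> split_ifs at c d <;> omega
  · intro p
    have a := arcCount_right_step hσ 0 p
    have b := arcCount_left_step σ p n
    have c := arcCount_of_le σ (i := 0) (j := 0) (by omega)
    have d := arcCount_of_left_ge σ n le_rfl
    simp only [Fin.lt_def] at a b
    unfold minRank
    push_cast
    split_ifs at a b <;> omega

end LinkPat

/-- for `σ ∈ S_n²(k)` with `k ≤ n/2 − 1` and `k < m ≤ n/2`, the set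
`F_m(σ) = {τ ∈ S_n²(m) : σ ≺ τ}` is nonempty and has a minimum element for `⪯`. -/
theorem exists_min_above (n k m : ℕ) (σ : Equiv.Perm (Fin n))
    (hσ : LinkPat.IsInvol σ) (hk : LinkPat.numArcs σ = k)
    (hkn : 2 * k + 2 ≤ n) (hkm : k < m) (hmn : 2 * m ≤ n) :
    (∃ τ : Equiv.Perm (Fin n), LinkPat.IsInvol τ ∧ LinkPat.numArcs τ = m ∧
        LinkPat.rlt σ τ) ∧
    ∃ σbar : Equiv.Perm (Fin n),
      (LinkPat.IsInvol σbar ∧ LinkPat.numArcs σbar = m ∧ LinkPat.rlt σ σbar) ∧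
      ∀ τ : Equiv.Perm (Fin n), LinkPat.IsInvol τ → LinkPat.numArcs τ = m →
        LinkPat.rlt σ τ → LinkPat.rle σbar τ := by
  subst hk
  obtain ⟨τ₀, hinv, hcount⟩ := LinkPat.exists_invol_arcCount_eq_minRank hσ hkm hmn
  have hnum : LinkPat.numArcs τ₀ = m := by
    have h1 := hcount 0 n (Nat.zero_le n) le_rfl
    have h2 := LinkPat.arcCount_of_le σ (i := 0) (j := 0) (by omega)
    have h3 := LinkPat.arcCount_of_left_ge σ n le_rfl
    have h4 := LinkPat.numArcs_eq_arcCount σ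
    rw [LinkPat.numArcs_eq_arcCount]
    unfold LinkPat.minRank at h1
    omega
  have hrlt : LinkPat.rlt σ τ₀ := by
    refine ⟨fun i j => ?_, ?_⟩
    · have h1 := hcount i (j + 1) i.isLt.le j.isLt
      rw [LinkPat.Rmat_eq_arcCount, LinkPat.Rmat_eq_arcCount]
      unfold LinkPat.minRank at h1
      omega
    · rintro rfl
      omega
  refine ⟨⟨τ₀, hinv, hnum, hrlt⟩, τ₀, ⟨hinv, hnum, hrlt⟩, fun τ hτ hτm hστ i j => ?_⟩
  have h1 := hcount i (j + 1) i.isLt.le j.isLt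
  have h2 := LinkPat.numArcs_le_arcCount hτ (i := i) (j := j + 1) i.isLt.le j.isLt
  have h3 := LinkPat.arcCount_le_of_rle hστ.1 (i := i) (j := j + 1) j.isLt
  have h4 := LinkPat.arcCount_le_of_rle hστ.1 (i := 0) (j := i) i.isLt.le
  have h5 := LinkPat.arcCount_le_of_rle hστ.1 (i := j + 1) (j := n) le_rfl
  rw [LinkPat.Rmat_eq_arcCount, LinkPat.Rmat_eq_arcCount]
  unfold LinkPat.minRank at h1
  omega
end

section
/- Let J = {j_1 < ... < j_k} be a k-element subset of {1,...,n} with j_s ≥ 2s for all s, and let (i_1,j_1), ..., (i_k,j_k) be the arcs of the greedy involution σ_J. Then for each l ∈ {1,...,k}, the arc (i_l,j_l) is external in σ_J if and only if l = k or j_s − j_l ≥ 2(s−l) for every s with l < s ≤ k. -/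
namespace LinkPat

variable {n : ℕ} {J : Finset (Fin n)} {σ : Equiv.Perm (Fin n)}

/-- If the partners of all elements of `J` beyond `j` also lie beyond `j`, then every interval
`(j, j']` holds two distinct points for each of its elements of `J`. -/
lemma two_mul_card_le_of_forall_lt (hinv : IsInvol σ) (hlt : ∀ p, σ p < p ↔ p ∈ J) {j : Fin n}
    (h : ∀ b ∈ J, j < b → j < σ b) (j' : Fin n) :
    2 * (J.filter fun x => j < x ∧ x ≤ j').card ≤ (j' : ℕ) - (j : ℕ) := by
  set A := J.filter fun x => j < x ∧ x ≤ j'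
  have hdisj : Disjoint A (A.image σ) := by
    rw [Finset.disjoint_left]
    intro x hx hx'
    obtain ⟨y, hy, rfl⟩ := Finset.mem_image.1 hx'
    have h1 := (hlt _).2 (Finset.mem_filter.1 hx).1
    have h2 := (hlt _).2 (Finset.mem_filter.1 hy).1
    rw [hinv y] at h1
    exact lt_asymm h1 h2
  have hsub : A ∪ A.image σ ⊆ Finset.Ioc j j' := by
    intro x hx
    rw [Finset.mem_Ioc]
    rcases Finset.mem_union.1 hx with hx | hx
    · exact (Finset.mem_filter.1 hx).2
    · obtain ⟨y, hy, rfl⟩ := Finset.mem_image.1 hx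
      obtain ⟨hyJ, hjy, hyj'⟩ := Finset.mem_filter.1 hy
      exact ⟨h y hyJ hjy, (((hlt y).2 hyJ).trans_le hyj').le⟩
  have hc := Finset.card_le_card hsub
  rw [Finset.card_union_of_disjoint hdisj, Finset.card_image_of_injective _ σ.injective,
    Fin.card_Ioc] at hc
  omega

/-- If the greedy rule sends `b ∈ J`, where `j < b`, to a point not beyond `j`, then the interval
`(j, b]` consists of elements of `J` and partners of its elements other than `b`. -/
lemma GreedyInv.lt_two_mul_card (hg : GreedyInv σ J) {j b : Fin n} (hb : b ∈ J) (hjb : j < b)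
    (h : σ b ≤ j) :
    (b : ℕ) - (j : ℕ) < 2 * (J.filter fun x => j < x ∧ x ≤ b).card := by
  obtain ⟨-, hlt, hmax⟩ := hg
  set A := J.filter fun x => j < x ∧ x ≤ b
  have hbA : b ∈ A := Finset.mem_filter.2 ⟨hb, hjb, le_rfl⟩
  have hsub : Finset.Ioc j b ⊆ A ∪ (A.erase b).image σ := by
    intro d hd
    obtain ⟨hjd, hdb⟩ := Finset.mem_Ioc.1 hd
    rw [Finset.mem_union]
    rcases hdb.eq_or_lt with rfl | hdb
    · exact Or.inl hbA
    · rcases hmax b hb d (h.trans_lt hjd) hdb with hdJ | ⟨c, hc, hcb, rfl⟩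
      · exact Or.inl (Finset.mem_filter.2 ⟨hdJ, hjd, hdb.le⟩)
      · exact Or.inr (Finset.mem_image_of_mem σ (Finset.mem_erase.2 ⟨hcb.ne,
          Finset.mem_filter.2 ⟨hc, hjd.trans ((hlt c).2 hc), hcb.le⟩⟩))
  have hc := (Finset.card_le_card hsub).trans (Finset.card_union_le _ _)
  rw [Finset.card_image_of_injective _ σ.injective, Finset.card_erase_of_mem hbA,
    Fin.card_Ioc] at hc
  have := Finset.card_pos.2 ⟨b, hbA⟩
  omega

/-- No arc of a greedy involution ending beyond `j ∈ J` starts in the interval `[σ j, j]`. -/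
lemma GreedyInv.lt_or_lt (hg : GreedyInv σ J) {j b : Fin n} (hj : j ∈ J) (hb : b ∈ J)
    (hjb : j < b) : σ b < σ j ∨ j < σ b := by
  obtain ⟨hinv, hlt, hmax⟩ := hg
  by_contra! hcon
  obtain ⟨h1, h2⟩ := hcon
  have hne : σ j ≠ σ b := fun h => hjb.ne (σ.injective h)
  have hbJ : σ b ∉ J := fun h => by
    have := (hlt _).2 h
    rw [hinv b] at this
    exact lt_asymm this ((hlt b).2 hb)
  rcases hmax j hj (σ b) (lt_of_le_of_ne h1 hne) (lt_of_le_of_ne h2 fun h => hbJ (h ▸ hj)) with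
    h | ⟨c, -, hcj, hcb⟩
  · exact hbJ h
  · exact (hcj.trans hjb).ne (σ.injective hcb)

end LinkPat

/-- an arc `(i_l,j_l) = (σ_J j, j)` of the greedy involution `σ_J` is
external iff `l = k` (i.e. `j` is the largest element of `J`) or
`j_s − j_l ≥ 2(s−l)` for every `s` with `l < s ≤ k` (i.e. for every `j' ∈ J` with
`j' > j` one has `j' − j ≥ 2·#{x ∈ J : j < x ≤ j'}`). -/
theorem greedy_external_iff (n k : ℕ) (J : Finset (Fin n)) (hcard : J.card = k)
    (hJ : LinkPat.JCond J) (σ : Equiv.Perm (Fin n)) (hg : LinkPat.GreedyInv σ J) :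
    ∀ j ∈ J,
      ((∀ a b : Fin n, LinkPat.IsArc σ a b → ¬(a < σ j ∧ j < b)) ↔
        ((∀ j' ∈ J, j' ≤ j) ∨
         ∀ j' ∈ J, j < j' →
           2 * (J.filter fun x => j < x ∧ x ≤ j').card ≤ (j' : ℕ) - (j : ℕ))) := by
  intro j hj
  have hinv := hg.1
  have hlt := hg.2.1
  constructor
  · intro hext
    refine Or.inr fun j' _ _ => LinkPat.two_mul_card_le_of_forall_lt hinv hlt ?_ j'
    intro b hb hjb
    exact (hg.lt_or_lt hj hb hjb).resolve_left fun h =>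
      hext (σ b) b ⟨(hlt b).2 hb, hinv b⟩ ⟨h, hjb⟩
  · rintro hcond a b ⟨hab, rfl⟩ ⟨haj, hjb⟩
    have hb : σ a ∈ J := (hlt _).1 (by rwa [hinv a])
    rcases hcond with hlast | hcond
    · exact (hlast _ hb).not_gt hjb
    · refine (hcond _ hb hjb).not_gt (hg.lt_two_mul_card hb hjb ?_)
      rw [hinv a]
      exact (haj.trans ((hlt j).2 hj)).le
end
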